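/- arXiv:2508.10375 — 9 statements merged into one kernel-verified Lean document; each statement's English description precedes it below -/
import Mathlib

section
/- Let n ≥ d ≥ 1 be integers and let β be a bivariate sequence of degree 2n that satisfies the (y−x^d) column relations. Let P_{2n} denote the real vector space of polynomials in two variables x, y of total degree at most 2n, and let L_β : P_{2n} → ℝ be the linear functional determined by L_β(x^i y^j) = β_{ij} for all i+j ≤ 2n. Then the family consisting of the polynomials f_{ij}(x,y) = x^i y^j − β_{ij} for 0 ≤ i ≤ d−1, j ≥ 0, 0 < i+j ≤ 2n, together with the polynomials g_{kl}(x,y) = (y − x^d)·x^k y^l for k,l ≥ 0 with k+l ≤ 2n−d, is a basis of the kernel of L_β. -/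
open MvPolynomial

noncomputable section

/-- The family of polynomials `f_{ij}(x,y) = x^i y^j − β_{ij}` (for `0 ≤ i ≤ d−1`,
`0 < i+j ≤ 2n`) together with `g_{kl}(x,y) = (y − x^d)·x^k y^l` (for `k+l ≤ 2n−d`). -/
def kerFamily (n d : ℕ) (β : ℕ → ℕ → ℝ) :
    ({p : ℕ × ℕ // p.1 < d ∧ 0 < p.1 + p.2 ∧ p.1 + p.2 ≤ 2 * n} ⊕
      {p : ℕ × ℕ // p.1 + p.2 ≤ 2 * n - d}) → MvPolynomial (Fin 2) ℝ :=
  Sum.elim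
    (fun p => X 0 ^ p.1.1 * X 1 ^ p.1.2 - C (β p.1.1 p.1.2))
    (fun p => (X 1 - X 0 ^ d) * (X 0 ^ p.1.1 * X 1 ^ p.1.2))

/-- Modulo the span of `kerFamily`, every monomial of degree at most `2n` is congruent to its
moment. -/
lemma monomial_sub_moment_mem_span_kerFamily (n d : ℕ) (hd : 1 ≤ d) (β : ℕ → ℕ → ℝ)
    (hβ00 : β 0 0 = 1)
    (hcol : ∀ i j : ℕ, i + j + d ≤ 2 * n → β (i + d) j = β i (j + 1)) (i j : ℕ)
    (hij : i + j ≤ 2 * n) :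
    (X 0 ^ i * X 1 ^ j - C (β i j) : MvPolynomial (Fin 2) ℝ) ∈
      Submodule.span ℝ (Set.range (kerFamily n d β)) := by
  induction i using Nat.strong_induction_on generalizing j with
  | _ i ih =>
    by_cases hid : i < d
    · by_cases h0 : 0 < i + j
      · exact Submodule.subset_span ⟨Sum.inl ⟨(i, j), hid, h0, hij⟩, rfl⟩
      · obtain ⟨rfl, rfl⟩ : i = 0 ∧ j = 0 := by omega
        simp [hβ00]
    · obtain ⟨k, rfl⟩ := Nat.exists_eq_add_of_le' (not_lt.mp hid)
      have hg : ((X 1 - X 0 ^ d) * (X 0 ^ k * X 1 ^ j) : MvPolynomial (Fin 2) ℝ) ∈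
          Submodule.span ℝ (Set.range (kerFamily n d β)) :=
        Submodule.subset_span ⟨Sum.inr ⟨(k, j), by simp only; omega⟩, rfl⟩
      have hk := ih k (by omega) (j + 1) (by omega)
      rw [hcol k j (by omega)]
      convert Submodule.sub_mem _ hk hg using 1
      ring

lemma monomial_fin_two_eq_X_pow_mul_X_pow (m : Fin 2 →₀ ℕ) :
    (monomial m 1 : MvPolynomial (Fin 2) ℝ) = X 0 ^ m 0 * X 1 ^ m 1 := by
  rw [monomial_eq, Finsupp.prod_fintype _ _ (by simp)]
  simp [Fin.prod_univ_two]

lemma X_pow_mul_X_pow_mem_restrictTotalDegree {i j N : ℕ} (h : i + j ≤ N) :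
    (X 0 ^ i * X 1 ^ j : MvPolynomial (Fin 2) ℝ) ∈ restrictTotalDegree (Fin 2) ℝ N := by
  rw [mem_restrictTotalDegree]
  refine (totalDegree_mul _ _).trans ?_
  simpa [totalDegree_X_pow] using h

lemma linearIndependent_X_pow_mul_X_pow :
    LinearIndependent ℝ
      (fun p : ℕ × ℕ => (X 0 ^ p.1 * X 1 ^ p.2 : MvPolynomial (Fin 2) ℝ)) := by
  let e : ℕ × ℕ → (Fin 2 →₀ ℕ) := fun p => Finsupp.equivFunOnFinite.symm ![p.1, p.2]
  have he : Function.Injective e := by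
    intro p q h
    have h0 := DFunLike.congr_fun h 0
    have h1 := DFunLike.congr_fun h 1
    exact Prod.ext (by simpa [e] using h0) (by simpa [e] using h1)
  have hfun : (fun p : ℕ × ℕ => (X 0 ^ p.1 * X 1 ^ p.2 : MvPolynomial (Fin 2) ℝ)) =
      basisMonomials (Fin 2) ℝ ∘ e := by
    funext p
    simp [e, monomial_fin_two_eq_X_pow_mul_X_pow]
  rw [hfun]
  exact (basisMonomials (Fin 2) ℝ).linearIndependent.comp e he

/-- A polynomial of degree at most `2n` is congruent to its image under the Riesz functional,
modulo the span of `kerFamily`. -/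
lemma sub_C_apply_mem_span_kerFamily (n d : ℕ) (hd : 1 ≤ d) (β : ℕ → ℕ → ℝ)
    (hβ00 : β 0 0 = 1)
    (hcol : ∀ i j : ℕ, i + j + d ≤ 2 * n → β (i + d) j = β i (j + 1))
    (L : MvPolynomial (Fin 2) ℝ →ₗ[ℝ] ℝ)
    (hL : ∀ i j : ℕ, i + j ≤ 2 * n → L (X 0 ^ i * X 1 ^ j) = β i j)
    {p : MvPolynomial (Fin 2) ℝ} (hp : p ∈ restrictTotalDegree (Fin 2) ℝ (2 * n)) :
    p - C (L p) ∈ Submodule.span ℝ (Set.range (kerFamily n d β)) := by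
  have key : p - C (L p) = ∑ m ∈ p.support,
      p.coeff m • (X 0 ^ m 0 * X 1 ^ m 1 - C (L (X 0 ^ m 0 * X 1 ^ m 1))) := by
    have hsum : p = ∑ m ∈ p.support,
        p.coeff m • (X 0 ^ m 0 * X 1 ^ m 1 : MvPolynomial (Fin 2) ℝ) := by
      conv_lhs => rw [p.as_sum]
      refine Finset.sum_congr rfl fun m _ => ?_
      rw [← monomial_fin_two_eq_X_pow_mul_X_pow, smul_monomial, smul_eq_mul, mul_one]
    have hLsum := congrArg L hsum
    rw [map_sum] at hLsum
    rw [hLsum]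
    conv_lhs => enter [1]; rw [hsum]
    simp only [map_sum, map_smul, smul_sub, Finset.sum_sub_distrib, smul_eq_mul, C_mul]
    simp only [smul_eq_C_mul]
  rw [key]
  refine Submodule.sum_mem _ fun m hm => Submodule.smul_mem _ _ ?_
  have hdeg : m 0 + m 1 ≤ 2 * n := by
    have h := (le_totalDegree hm).trans ((mem_restrictTotalDegree _ _ _).mp hp)
    rwa [Finsupp.sum_fintype _ _ (by simp), Fin.sum_univ_two] at h
  rw [hL _ _ hdeg]
  exact monomial_sub_moment_mem_span_kerFamily n d hd β hβ00 hcol _ _ hdeg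

/-- The family `kerFamily` together with the constant `1` is linearly independent: it spans all
monomials of degree at most `2n`, and has no more members than there are such monomials. -/
lemma linearIndependent_option_elim_kerFamily (n d : ℕ) (hd : 1 ≤ d) (hdn : d ≤ n)
    (β : ℕ → ℕ → ℝ) (hβ00 : β 0 0 = 1)
    (hcol : ∀ i j : ℕ, i + j + d ≤ 2 * n → β (i + d) j = β i (j + 1)) :
    LinearIndependent ℝ (fun o : Option _ => o.elim 1 (kerFamily n d β)) := by
  let T := {p : ℕ × ℕ // p.1 + p.2 ≤ 2 * n}
  have : Finite T := ((Set.finite_Iic (2 * n, 2 * n)).subset fun p (hp : p.1 + p.2 ≤ 2 * n) =>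
    Prod.mk_le_mk.mpr ⟨by omega, by omega⟩).to_subtype
  let φ : Option ({p : ℕ × ℕ // p.1 < d ∧ 0 < p.1 + p.2 ∧ p.1 + p.2 ≤ 2 * n} ⊕
      {p : ℕ × ℕ // p.1 + p.2 ≤ 2 * n - d}) → T := fun o => o.elim ⟨(0, 0), by simp⟩
    (Sum.elim (fun p => ⟨p.1, p.2.2.2⟩)
      (fun p => ⟨(p.1.1 + d, p.1.2), by have := p.2; simp only; omega⟩))
  have hφ : Function.Injective φ := by
    rintro (_ | ⟨⟨a, b⟩, h⟩ | ⟨⟨a, b⟩, h⟩) (_ | ⟨⟨a', b'⟩, h'⟩ | ⟨⟨a', b'⟩, h'⟩) hab <;>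
      have h₁ := congrArg (fun t => t.1.1) hab <;>
      have h₂ := congrArg (fun t => t.1.2) hab <;>
      clear hab hcol <;> simp [φ] at * <;> omega
  have := Finite.of_injective φ hφ
  have := Fintype.ofFinite T
  have := Fintype.ofFinite (Option ({p : ℕ × ℕ // p.1 < d ∧ 0 < p.1 + p.2 ∧ p.1 + p.2 ≤ 2 * n} ⊕
      {p : ℕ × ℕ // p.1 + p.2 ≤ 2 * n - d}))
  rw [linearIndependent_iff_card_le_finrank_span]
  refine (Fintype.card_le_of_injective φ hφ).trans ?_
  have hT : LinearIndependent ℝ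
      (fun t : T => (X 0 ^ t.1.1 * X 1 ^ t.1.2 : MvPolynomial (Fin 2) ℝ)) :=
    linearIndependent_X_pow_mul_X_pow.comp _ Subtype.val_injective
  rw [← finrank_span_eq_card hT, Set.finrank]
  have := FiniteDimensional.span_of_finite ℝ
    (Set.finite_range (fun o : Option _ => o.elim 1 (kerFamily n d β)))
  refine Submodule.finrank_mono (Submodule.span_le.mpr ?_)
  rintro _ ⟨t, rfl⟩
  have hF := Submodule.span_mono (R := ℝ)
    (s := Set.range (kerFamily n d β))
    (t := Set.range (fun o : Option _ => o.elim 1 (kerFamily n d β)))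
    (by rintro _ ⟨a, rfl⟩; exact ⟨some a, rfl⟩)
    (monomial_sub_moment_mem_span_kerFamily n d hd β hβ00 hcol _ _ t.2)
  have h1 := Submodule.smul_mem (Submodule.span ℝ
    (Set.range (fun o : Option _ => o.elim 1 (kerFamily n d β)))) (β t.1.1 t.1.2)
    (Submodule.subset_span ⟨none, rfl⟩)
  have h := Submodule.add_mem _ hF h1
  simpa [smul_eq_C_mul] using h

/-- The pure `y = x^d` basis of the kernel of the Riesz functional:
if `β` is a bivariate sequence of degree `2n` (normalized by `β 0 0 = 1`) satisfying
the `(y − x^d)` column relations, and `L` is a linear functional with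
`L (x^i y^j) = β i j` for `i+j ≤ 2n`, then the family `{f_{ij}} ∪ {g_{kl}}`
is a basis of the kernel of the restriction of `L` to polynomials of total degree
at most `2n` (i.e. it is linearly independent and spans
`restrictTotalDegree (Fin 2) ℝ (2n) ⊓ ker L`). -/
theorem pure_basis_of_kernel (n d : ℕ) (hd : 1 ≤ d) (hdn : d ≤ n)
    (β : ℕ → ℕ → ℝ) (hβ00 : β 0 0 = 1)
    (hcol : ∀ i j : ℕ, i + j + d ≤ 2 * n → β (i + d) j = β i (j + 1))
    (L : MvPolynomial (Fin 2) ℝ →ₗ[ℝ] ℝ)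
    (hL : ∀ i j : ℕ, i + j ≤ 2 * n → L (X 0 ^ i * X 1 ^ j) = β i j) :
    LinearIndependent ℝ (kerFamily n d β) ∧
      Submodule.span ℝ (Set.range (kerFamily n d β)) =
        restrictTotalDegree (Fin 2) ℝ (2 * n) ⊓ LinearMap.ker L := by
  refine ⟨(linearIndependent_option_elim_kerFamily n d hd hdn β hβ00 hcol).comp some
    (Option.some_injective _), le_antisymm (Submodule.span_le.mpr ?_) ?_⟩
  · have hL1 : L 1 = 1 := by simpa [hβ00] using hL 0 0 (by omega)
    have hC (c : ℝ) : L (C c) = c := by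
      rw [← mul_one (C c), ← smul_eq_C_mul, map_smul, hL1, smul_eq_mul, mul_one]
    rintro _ ⟨⟨⟨i, j⟩, -, -, hij⟩ | ⟨⟨k, l⟩, hkl⟩, rfl⟩
    · refine ⟨Submodule.sub_mem _ (X_pow_mul_X_pow_mem_restrictTotalDegree hij) ?_, ?_⟩
      · simp [mem_restrictTotalDegree]
      · simp only [kerFamily, Sum.elim_inl, SetLike.mem_coe, LinearMap.mem_ker, map_sub, hC]
        rw [hL i j hij, sub_self]
    · simp only at hkl
      have hexp : kerFamily n d β (Sum.inr ⟨(k, l), hkl⟩) =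
          X 0 ^ k * X 1 ^ (l + 1) - X 0 ^ (k + d) * X 1 ^ l := by
        simp only [kerFamily, Sum.elim_inr]
        ring
      rw [hexp]
      refine ⟨Submodule.sub_mem _ (X_pow_mul_X_pow_mem_restrictTotalDegree (by omega))
        (X_pow_mul_X_pow_mem_restrictTotalDegree (by omega)), ?_⟩
      rw [SetLike.mem_coe, LinearMap.mem_ker, map_sub, hL _ _ (by omega), hL _ _ (by omega),
        hcol k l (by omega), sub_self]
  · rintro p ⟨hp, hker⟩
    have h := sub_C_apply_mem_span_kerFamily n d hd β hβ00 hcol L hL hp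
    rwa [LinearMap.mem_ker.mp hker, C_0, sub_zero] at h
end
end

section
/- Fix positive integers n and d, and let F := {(i,j) : 0 ≤ i ≤ d−1, j ≥ 0, i+dj ≤ 2nd, i+j > 2n}. Suppose (i,j) ∈ F and k, l are integers with 0 ≤ k ≤ nd, 0 ≤ l ≤ nd and k+l = i+dj. Then (k mod d) + ⌊k/d⌋ > n or (l mod d) + ⌊l/d⌋ > n; equivalently, at least one of the pairs (k mod d, ⌊k/d⌋ + n) and (l mod d, ⌊l/d⌋ + n) belongs to F. -/
/-- For `(i,j)` in the auxiliary index set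
`F = {(i,j) : 0 ≤ i ≤ d−1, j ≥ 0, i+dj ≤ 2nd, i+j > 2n}` and `k, l ≤ nd` with
`k + l = i + d·j`, at least one of `(k mod d) + ⌊k/d⌋` and `(l mod d) + ⌊l/d⌋`
exceeds `n` (i.e. at least one of the corresponding moments is auxiliary). -/
theorem auxiliary_pair (n d : ℕ) (hn : 1 ≤ n) (hd : 1 ≤ d)
    (i j k l : ℕ)
    (hiF : i ≤ d - 1) (hijF : i + d * j ≤ 2 * n * d) (hijF' : 2 * n < i + j)
    (hk : k ≤ n * d) (hl : l ≤ n * d) (hkl : k + l = i + d * j) :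
    n < k % d + k / d ∨ n < l % d + l / d := by
  have hid : i < d := by omega
  have hmod : (k + l) % d = i := by
    rw [hkl, Nat.add_mul_mod_self_left, Nat.mod_eq_of_lt hid]
  have hdiv : (k + l) / d = j := by
    rw [hkl, Nat.add_mul_div_left _ _ hd, Nat.div_eq_of_lt hid, zero_add]
  rw [Nat.add_div hd] at hdiv
  have hcarry := Nat.add_mod_add_ite k l d
  rw [hmod] at hcarry
  split_ifs at hdiv hcarry <;> omega
end

section
/- Let n ≥ 1, d ≥ 1 be integers, let β be a bivariate sequence of degree 2n, let A = (A_{ij})_{(i,j)∈F} be real numbers, and let C[A] be the core matrix. For vectors r = (r_0,…,r_{nd}) and s = (s_0,…,s_{nd}) in ℝ^{nd+1} and integers i,j ≥ 0 with i ≤ d−1, define h_{i,j}(r,s) := Σ (r_k r_l + s_k s_l), the sum over all pairs of integers k,l with 0 ≤ k,l ≤ nd, k+l > 0 and k+l = i+dj. Assume h_{i,j}(r,s) = 0 for every (i,j) ∈ F. Then ⟨C[A]r, r⟩ + ⟨C[A]s, s⟩ = r_0² + s_0² + Σ_{0 ≤ i ≤ d−1, j ≥ 0, 0 < i+j ≤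 2n} h_{i,j}(r,s)·β_{ij}; in particular ⟨C[A]r, r⟩ + ⟨C[A]s, s⟩ = 0 if and only if −Σ_{0 ≤ i ≤ d−1, j ≥ 0, 0 < i+j ≤ 2n} h_{i,j}(r,s)·β_{ij} = r_0² + s_0². -/
open Matrix

noncomputable section

/-- The sequence `γ_p` built from the bivariate sequence `β` and auxiliary
moments `A`: `γ_p = β_{p mod d, ⌊p/d⌋}` if `(p mod d) + ⌊p/d⌋ ≤ 2n`, and
`γ_p = A_{p mod d, ⌊p/d⌋}` otherwise. -/
def coreGamma (n d : ℕ) (β A : ℕ → ℕ → ℝ) (p : ℕ) : ℝ :=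
  if p % d + p / d ≤ 2 * n then β (p % d) (p / d) else A (p % d) (p / d)

/-- The `(nd+1) × (nd+1)` core (Hankel) matrix `C[A]` with entries `γ_{p+q}`. -/
def coreMatrix (n d : ℕ) (β A : ℕ → ℕ → ℝ) :
    Matrix (Fin (n * d + 1)) (Fin (n * d + 1)) ℝ :=
  Matrix.of fun p q => coreGamma n d β A ((p : ℕ) + (q : ℕ))

/-- The quadratic form `h_{i,j}(r,s) = Σ_{0 ≤ k,l ≤ nd, k+l>0, k+l = i+dj} (r_k r_l + s_k s_l)`. -/
def hQuad (n d : ℕ) (r s : Fin (n * d + 1) → ℝ) (i j : ℕ) : ℝ :=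
  ∑ k : Fin (n * d + 1), ∑ l : Fin (n * d + 1),
    if (k : ℕ) + (l : ℕ) = i + d * j ∧ 0 < (k : ℕ) + (l : ℕ)
    then r k * r l + s k * s l else 0

/-- Base-`d` division: each `p ≤ m * d` is `i + d * j` for exactly one pair with
`i < d` and `j ≤ m`. -/
theorem sum_range_ite_eq_add_mul {M : Type*} [AddCommMonoid M] {d m p : ℕ} (hd : 0 < d)
    (hp : p ≤ m * d) (x : M) :
    ∑ i ∈ Finset.range d, ∑ j ∈ Finset.range (m + 1), (if p = i + d * j then x else 0) = x := by
  have hdiv : p / d ≤ m := Nat.div_le_of_le_mul (by rwa [mul_comm])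
  rw [Finset.sum_eq_single_of_mem (p % d) (Finset.mem_range.2 (Nat.mod_lt p hd)),
    Finset.sum_eq_single_of_mem (p / d) (Finset.mem_range.2 (Nat.lt_succ_of_le hdiv)),
    if_pos (Nat.mod_add_div p d).symm]
  · intro j _ hj
    refine if_neg fun h => hj ?_
    have := Nat.mod_add_div p d
    exact Nat.eq_of_mul_eq_mul_left hd (by omega)
  · intro i hi hne
    refine Finset.sum_eq_zero fun j _ => if_neg fun h => hne ?_
    rw [h, Nat.add_mul_mod_self_left, Nat.mod_eq_of_lt (Finset.mem_range.1 hi)]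

theorem coreGamma_add_mul (n : ℕ) {d i : ℕ} (β A : ℕ → ℕ → ℝ) (hi : i < d) (j : ℕ) :
    coreGamma n d β A (i + d * j) = if i + j ≤ 2 * n then β i j else A i j := by
  have hdiv : (i + d * j) / d = j := by
    rw [Nat.add_mul_div_left _ _ (Nat.zero_lt_of_lt hi), Nat.div_eq_of_lt hi, zero_add]
  simp only [coreGamma, Nat.add_mul_mod_self_left, Nat.mod_eq_of_lt hi, hdiv]

theorem coreGamma_zero (n d : ℕ) (β A : ℕ → ℕ → ℝ) : coreGamma n d β A 0 = β 0 0 := by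
  simp [coreGamma]

theorem hQuad_zero_zero (n d : ℕ) (r s : Fin (n * d + 1) → ℝ) : hQuad n d r s 0 0 = 0 :=
  Finset.sum_eq_zero fun _ _ => Finset.sum_eq_zero fun _ _ => if_neg (by omega)

theorem hQuad_eq_zero_of_lt {n d i j : ℕ} (r s : Fin (n * d + 1) → ℝ)
    (h : 2 * n * d < i + d * j) : hQuad n d r s i j = 0 :=
  Finset.sum_eq_zero fun k _ => Finset.sum_eq_zero fun l _ => if_neg <| by
    rw [mul_assoc] at h
    have := k.is_lt
    have := l.is_lt
    omega

theorem dotProduct_coreMatrix_mulVec (n d : ℕ) (β A : ℕ → ℕ → ℝ) (v : Fin (n * d + 1) → ℝ) :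
    v ⬝ᵥ coreMatrix n d β A *ᵥ v =
      ∑ k, ∑ l, v k * v l * coreGamma n d β A ((k : ℕ) + (l : ℕ)) := by
  simp only [dotProduct, mulVec, coreMatrix, of_apply, Finset.mul_sum]
  exact Finset.sum_congr rfl fun k _ => Finset.sum_congr rfl fun l _ => by ring

/-- Grouping the entries of the Hankel form by antidiagonals, apart from the corner entry. -/
theorem sum_hQuad_mul_coreGamma (n : ℕ) {d : ℕ} (hd : 0 < d) (β A : ℕ → ℕ → ℝ)
    (r s : Fin (n * d + 1) → ℝ) :
    ∑ i ∈ Finset.range d, ∑ j ∈ Finset.range (2 * n + 1),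
        hQuad n d r s i j * coreGamma n d β A (i + d * j) =
      ∑ k : Fin (n * d + 1), ∑ l : Fin (n * d + 1),
        if 0 < (k : ℕ) + (l : ℕ)
        then (r k * r l + s k * s l) * coreGamma n d β A ((k : ℕ) + (l : ℕ)) else 0 := by
  have hterm (i j : ℕ) : hQuad n d r s i j * coreGamma n d β A (i + d * j) =
      ∑ k : Fin (n * d + 1), ∑ l : Fin (n * d + 1), if (k : ℕ) + (l : ℕ) = i + d * j then
        (if 0 < (k : ℕ) + (l : ℕ)
          then (r k * r l + s k * s l) * coreGamma n d β A ((k : ℕ) + (l : ℕ)) else 0)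
        else 0 := by
    simp only [hQuad, Finset.sum_mul]
    refine Finset.sum_congr rfl fun k _ => Finset.sum_congr rfl fun l _ => ?_
    by_cases h : (k : ℕ) + (l : ℕ) = i + d * j
    · simp only [h, true_and, if_true, ite_mul, zero_mul]
    · simp only [h, false_and, if_false, zero_mul]
  simp only [hterm]
  simp_rw [Finset.sum_comm (s := Finset.range (2 * n + 1))]
  rw [Finset.sum_comm]
  refine Finset.sum_congr rfl fun k _ => ?_
  rw [Finset.sum_comm]
  refine Finset.sum_congr rfl fun l _ => sum_range_ite_eq_add_mul hd ?_ _
  rw [mul_assoc]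
  have := k.is_lt
  have := l.is_lt
  omega

theorem dotProduct_coreMatrix_add (n : ℕ) {d : ℕ} (hd : 0 < d) (β A : ℕ → ℕ → ℝ)
    (r s : Fin (n * d + 1) → ℝ) :
    r ⬝ᵥ coreMatrix n d β A *ᵥ r + s ⬝ᵥ coreMatrix n d β A *ᵥ s =
      (r 0 ^ 2 + s 0 ^ 2) * β 0 0 +
        ∑ i ∈ Finset.range d, ∑ j ∈ Finset.range (2 * n + 1),
          hQuad n d r s i j * coreGamma n d β A (i + d * j) := by
  have hcorner : (r 0 ^ 2 + s 0 ^ 2) * β 0 0 =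
      ∑ k : Fin (n * d + 1), ∑ l : Fin (n * d + 1),
        if k = 0 then (if l = 0 then (r 0 ^ 2 + s 0 ^ 2) * β 0 0 else 0) else 0 := by
    simp
  rw [sum_hQuad_mul_coreGamma n hd, hcorner, dotProduct_coreMatrix_mulVec,
    dotProduct_coreMatrix_mulVec]
  simp only [← Finset.sum_add_distrib]
  refine Finset.sum_congr rfl fun k _ => Finset.sum_congr rfl fun l _ => ?_
  by_cases hk : k = 0
  · by_cases hl : l = 0
    · subst hk hl
      simp only [Fin.val_zero, add_zero, coreGamma_zero, lt_irrefl, if_true, if_false]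
      ring
    · have hpos : 0 < (k : ℕ) + (l : ℕ) := by
        have := Fin.val_ne_zero_iff.2 hl
        omega
      rw [if_pos hk, if_neg hl, if_pos hpos]
      ring
  · have hpos : 0 < (k : ℕ) + (l : ℕ) := by
      have := Fin.val_ne_zero_iff.2 hk
      omega
    rw [if_neg hk, if_pos hpos]
    ring

/-- If `r, s ∈ ℝ^{nd+1}` satisfy the auxiliary requirements `h_{i,j}(r,s) = 0`
for all `(i,j) ∈ F`, then
`⟨C[A]r, r⟩ + ⟨C[A]s, s⟩ = r_0² + s_0² + Σ_{0≤i≤d−1, 0<i+j≤2n} h_{i,j}(r,s)·β_{ij}`;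
in particular `⟨C[A]r, r⟩ + ⟨C[A]s, s⟩ = 0` iff
`−Σ h_{i,j}(r,s)·β_{ij} = r_0² + s_0²`. -/
theorem core_inner_product_expression (n d : ℕ) (hn : 1 ≤ n) (hd : 1 ≤ d)
    (β A : ℕ → ℕ → ℝ) (hβ00 : β 0 0 = 1)
    (r s : Fin (n * d + 1) → ℝ)
    (hreq : ∀ i j : ℕ, i ≤ d - 1 → i + d * j ≤ 2 * n * d → 2 * n < i + j →
      hQuad n d r s i j = 0) :
    (r ⬝ᵥ coreMatrix n d β A *ᵥ r + s ⬝ᵥ coreMatrix n d β A *ᵥ s =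
      r 0 ^ 2 + s 0 ^ 2 +
        ∑ i ∈ Finset.range d, ∑ j ∈ Finset.range (2 * n + 1),
          (if 0 < i + j ∧ i + j ≤ 2 * n then hQuad n d r s i j * β i j else 0)) ∧
    (r ⬝ᵥ coreMatrix n d β A *ᵥ r + s ⬝ᵥ coreMatrix n d β A *ᵥ s = 0 ↔
      -(∑ i ∈ Finset.range d, ∑ j ∈ Finset.range (2 * n + 1),
          (if 0 < i + j ∧ i + j ≤ 2 * n then hQuad n d r s i j * β i j else 0)) =
        r 0 ^ 2 + s 0 ^ 2) := by
  have hterm : ∀ i ∈ Finset.range d, ∀ j ∈ Finset.range (2 * n + 1),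
      hQuad n d r s i j * coreGamma n d β A (i + d * j) =
        if 0 < i + j ∧ i + j ≤ 2 * n then hQuad n d r s i j * β i j else 0 := by
    intro i hi j _
    rw [Finset.mem_range] at hi
    rw [coreGamma_add_mul n β A hi]
    by_cases hle : i + j ≤ 2 * n
    · by_cases hpos : 0 < i + j
      · rw [if_pos hle, if_pos ⟨hpos, hle⟩]
      · obtain ⟨rfl, rfl⟩ : i = 0 ∧ j = 0 := by omega
        simp [hQuad_zero_zero]
    · have hzero : hQuad n d r s i j = 0 := by
        rcases le_or_gt (i + d * j) (2 * n * d) with h | h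
        · exact hreq i j (by omega) h (by omega)
        · exact hQuad_eq_zero_of_lt r s h
      simp [hzero]
  have hmain := dotProduct_coreMatrix_add n hd β A r s
  rw [hβ00, mul_one,
    Finset.sum_congr rfl fun i hi => Finset.sum_congr rfl (hterm i hi)] at hmain
  refine ⟨hmain, ?_⟩
  rw [hmain, neg_eq_iff_add_eq_zero, add_comm]
end
end

section
/- Let n ≥ d ≥ 1 be integers and let β be a bivariate sequence of degree 2n such that M_n(β) is positive semidefinite and (y−x^d)-pure. If there exist real numbers A_{ij}, (i,j) ∈ F, such that the core matrix C[A] is positive definite, then for every x_0 ∈ ℝ there exists a finitely atomic representing measure for β whose support contains the point (x_0, x_0^d); moreover, every representing measure for β is supported in the curve Γ = {(x, x^d) : x ∈ ℝ}. -/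
open MeasureTheory Matrix

noncomputable section

/-- Index set for the moment matrix `M_n(β)`: pairs `(i,j)` with `i + j ≤ n`. -/
abbrev MomIdx (n : ℕ) : Type :=
  {p : Fin (n + 1) × Fin (n + 1) // (p.1 : ℕ) + (p.2 : ℕ) ≤ n}

/-- Index set for the compressed moment matrix `M̂_n(β)`: pairs `(i,j)` with
`i + j ≤ n` and `i ≤ d − 1`. -/
abbrev MomIdxHat (n d : ℕ) : Type :=
  {p : Fin (n + 1) × Fin (n + 1) // (p.1 : ℕ) + (p.2 : ℕ) ≤ n ∧ (p.1 : ℕ) < d}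

/-- The moment matrix `M_n(β)`, with entry `β_{i+k, j+l}` in row `(i,j)`,
column `(k,l)`. -/
def momentMatrix (n : ℕ) (β : ℕ → ℕ → ℝ) : Matrix (MomIdx n) (MomIdx n) ℝ :=
  Matrix.of fun p q => β ((p.1.1 : ℕ) + (q.1.1 : ℕ)) ((p.1.2 : ℕ) + (q.1.2 : ℕ))

/-- The compressed moment matrix `M̂_n(β)` (rows and columns `(i,j)` with `i ≤ d−1`). -/
def momentMatrixHat (n d : ℕ) (β : ℕ → ℕ → ℝ) :
    Matrix (MomIdxHat n d) (MomIdxHat n d) ℝ :=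
  Matrix.of fun p q => β ((p.1.1 : ℕ) + (q.1.1 : ℕ)) ((p.1.2 : ℕ) + (q.1.2 : ℕ))

/-- `β` is a bivariate sequence of degree `2n` such that `M_n(β)` is positive
semidefinite and `(y − x^d)`-pure: `β_{00} = 1`, `β` satisfies the `(y − x^d)`
column relations, `M_n(β)` is positive semidefinite, and `M̂_n(β)` is positive
definite. -/
def IsPure (n d : ℕ) (β : ℕ → ℕ → ℝ) : Prop :=
  β 0 0 = 1 ∧
  (∀ i j : ℕ, i + j + d ≤ 2 * n → β (i + d) j = β i (j + 1)) ∧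
  (momentMatrix n β).PosSemidef ∧
  (momentMatrixHat n d β).PosDef

/-- `μ` is a representing measure for the bivariate sequence `β` of degree `2n`. -/
def IsRepMeasure (n : ℕ) (β : ℕ → ℕ → ℝ) (μ : Measure (ℝ × ℝ)) : Prop :=
  ∀ i j : ℕ, i + j ≤ 2 * n →
    Integrable (fun p : ℝ × ℝ => p.1 ^ i * p.2 ^ j) μ ∧
    (∫ p : ℝ × ℝ, p.1 ^ i * p.2 ^ j ∂μ) = β i j

open scoped MatrixOrder in
/-- A real positive definite matrix is of the form `Bᵀ B` with `B` invertible. -/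
theorem exists_isUnit_transpose_mul_self {ι : Type*} [Fintype ι] [DecidableEq ι]
    {H : Matrix ι ι ℝ} (hH : H.PosDef) : ∃ B : Matrix ι ι ℝ, IsUnit B ∧ Bᵀ * B = H := by
  obtain ⟨B, hB⟩ := CStarAlgebra.nonneg_iff_eq_star_mul_self.mp hH.posSemidef.nonneg
  rw [star_eq_conjTranspose, conjTranspose_eq_transpose_of_trivial] at hB
  refine ⟨B, ?_, hB.symm⟩
  have hu := hH.isUnit
  rw [hB, isUnit_iff_isUnit_det, det_mul] at hu
  exact (isUnit_iff_isUnit_det B).mpr (isUnit_of_mul_isUnit_right hu)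

/-- Simultaneous diagonalization of a positive definite and a symmetric form. -/
theorem exists_simultaneous_diagonalization {ι : Type*} [Fintype ι] [DecidableEq ι]
    {H K : Matrix ι ι ℝ} (hH : H.PosDef) (hK : Kᵀ = K) :
    ∃ (C : Matrix ι ι ℝ) (l : ι → ℝ), IsUnit C ∧ Cᵀ * C = H ∧ Cᵀ * diagonal l * C = K := by
  obtain ⟨B, hB, hBH⟩ := exists_isUnit_transpose_mul_self hH
  have hdet : IsUnit B.det := (isUnit_iff_isUnit_det B).mp hB
  have hdetT : IsUnit Bᵀ.det := by rwa [det_transpose]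
  have hS : (B⁻¹ᵀ * K * B⁻¹).IsHermitian := by
    simp only [IsHermitian, conjTranspose_eq_transpose_of_trivial, transpose_mul,
      transpose_transpose, hK, Matrix.mul_assoc]
  have hspec := hS.spectral_theorem
  rw [Unitary.conjStarAlgAut_apply] at hspec
  set U : Matrix ι ι ℝ := (hS.eigenvectorUnitary : Matrix ι ι ℝ)
  have hUU : U * Uᵀ = 1 := by
    have := Unitary.mul_star_self_of_mem hS.eigenvectorUnitary.2
    rwa [star_eq_conjTranspose, conjTranspose_eq_transpose_of_trivial] at this
  have hUdet : IsUnit U.det := IsUnit.of_mul_eq_one (Uᵀ.det) (by rw [← det_mul, hUU, det_one])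
  refine ⟨Uᵀ * B, hS.eigenvalues, ?_, ?_, ?_⟩
  · rw [isUnit_iff_isUnit_det, det_mul, det_transpose]
    exact hUdet.mul hdet
  · rw [transpose_mul, transpose_transpose, Matrix.mul_assoc, ← Matrix.mul_assoc U, hUU,
      Matrix.one_mul, hBH]
  · have hspec' : U * diagonal hS.eigenvalues * Uᵀ = B⁻¹ᵀ * K * B⁻¹ :=
      hspec.symm
    calc (Uᵀ * B)ᵀ * diagonal hS.eigenvalues * (Uᵀ * B)
        = Bᵀ * (U * diagonal hS.eigenvalues * Uᵀ) * B := by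
          simp only [transpose_mul, transpose_transpose, Matrix.mul_assoc]
      _ = (Bᵀ * Bᵀ⁻¹) * K * (B⁻¹ * B) := by
          rw [hspec', transpose_nonsing_inv]
          simp only [Matrix.mul_assoc]
      _ = K := by
          rw [mul_nonsing_inv _ hdetT, nonsing_inv_mul _ hdet, Matrix.one_mul, Matrix.mul_one]

/-- A sequence with positive definite Hankel matrix of size `m + 1` has a quadrature formula with
`m + 1` nodes which is exact up to degree `2 m`. -/
theorem exists_quadrature_of_hankel_posDef (m : ℕ) (g : ℕ → ℝ)
    (hg : (Matrix.of fun p q : Fin (m + 1) => g ((p : ℕ) + (q : ℕ))).PosDef) :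
    ∃ (l w : Fin (m + 1) → ℝ), (∀ i, 0 ≤ w i) ∧
      ∀ k ≤ 2 * m, g k = ∑ i, w i * l i ^ k := by
  obtain ⟨C, l, hCu, hC, hCl⟩ := exists_simultaneous_diagonalization hg
    (K := Matrix.of fun p q : Fin (m + 1) => g ((p : ℕ) + (q : ℕ) + 1))
    (by ext p q; simp [add_comm])
  have hCT : IsUnit Cᵀ := by
    rw [isUnit_iff_isUnit_det, det_transpose]
    exact (isUnit_iff_isUnit_det C).mp hCu
  have hstep : ∀ (k : ℕ) (hk : k + 1 < m + 1) (i : Fin (m + 1)),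
      C i ⟨k + 1, hk⟩ = l i * C i ⟨k, by omega⟩ := by
    intro k hk i
    have h : Cᵀ *ᵥ (fun i => l i * C i ⟨k, by omega⟩) = Cᵀ *ᵥ (fun i => C i ⟨k + 1, hk⟩) := by
      ext p
      have h1 := congrFun (congrFun hC p) ⟨k + 1, hk⟩
      have h2 := congrFun (congrFun hCl p) ⟨k, by omega⟩
      rw [Matrix.mul_assoc, Matrix.mul_apply] at h2
      rw [Matrix.mul_apply] at h1
      simp only [diagonal_mul, Matrix.of_apply] at h1 h2
      simp only [mulVec, dotProduct]
      rw [h1, h2, add_assoc]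
    exact (congrFun (mulVec_injective_of_isUnit hCT h) i).symm
  have hpow : ∀ (k : ℕ) (hk : k < m + 1) (i : Fin (m + 1)),
      C i ⟨k, hk⟩ = l i ^ k * C i 0 := by
    intro k
    induction k with
    | zero => intro hk i; simp
    | succ k ih => intro hk i; rw [hstep k hk i, ih (by omega) i, pow_succ]; ring
  refine ⟨l, fun i => C i 0 ^ 2, fun i => sq_nonneg _, fun k hk => ?_⟩
  obtain ⟨a, b, ha, hb, rfl⟩ : ∃ a b : ℕ, a < m + 1 ∧ b < m + 1 ∧ k = a + b :=
    ⟨k / 2, k - k / 2, by omega, by omega, by omega⟩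
  have h := congrFun (congrFun hC ⟨a, ha⟩) ⟨b, hb⟩
  simp only [Matrix.mul_apply, transpose_apply, Matrix.of_apply] at h
  rw [← h]
  refine Finset.sum_congr rfl fun i _ => ?_
  rw [hpow a ha i, hpow b hb i]
  ring

/-- A positive definite matrix stays positive definite after subtracting a small multiple of a
rank one matrix. -/
theorem Matrix.PosDef.exists_sub_smul_vecMulVec {ι : Type*} [Fintype ι] [DecidableEq ι]
    {H : Matrix ι ι ℝ} (hH : H.PosDef) (v : ι → ℝ) :
    ∃ ε : ℝ, 0 < ε ∧ (H - ε • vecMulVec v v).PosDef := by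
  obtain ⟨B, hB, hBH⟩ := exists_isUnit_transpose_mul_self hH
  have hdetT : IsUnit Bᵀ.det := by
    rw [det_transpose]
    exact (isUnit_iff_isUnit_det B).mp hB
  set w := Bᵀ⁻¹ *ᵥ v with hw
  have hv : Bᵀ *ᵥ w = v := by rw [hw, mulVec_mulVec, mul_nonsing_inv _ hdetT, one_mulVec]
  have hw0 : 0 ≤ w ⬝ᵥ w := Finset.sum_nonneg fun i _ => mul_self_nonneg _
  refine ⟨(1 + w ⬝ᵥ w)⁻¹, by positivity, .of_dotProduct_mulVec_pos ?_ fun x hx => ?_⟩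
  · refine hH.1.sub ?_
    ext i j
    simp [vecMulVec_apply, mul_comm]
  · have hBx : B *ᵥ x ≠ 0 := fun h =>
      hx (mulVec_injective_of_isUnit hB (h.trans (mulVec_zero B).symm))
    have hpos : 0 < (B *ᵥ x) ⬝ᵥ (B *ᵥ x) :=
      lt_of_le_of_ne (Finset.sum_nonneg fun i _ => mul_self_nonneg _)
        fun h => hBx (dotProduct_self_eq_zero.mp h.symm)
    have hcs : (w ⬝ᵥ (B *ᵥ x)) ^ 2 ≤ (w ⬝ᵥ w) * ((B *ᵥ x) ⬝ᵥ (B *ᵥ x)) := by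
      simpa [dotProduct, sq] using Finset.sum_mul_sq_le_sq_mul_sq Finset.univ w (B *ᵥ x)
    have hvx : v ⬝ᵥ x = w ⬝ᵥ (B *ᵥ x) := by
      rw [← hv, mulVec_transpose, dotProduct_mulVec]
    have hHx : x ⬝ᵥ (H *ᵥ x) = (B *ᵥ x) ⬝ᵥ (B *ᵥ x) := by
      rw [← hBH, ← mulVec_mulVec, dotProduct_mulVec, vecMul_transpose]
    have hval : star x ⬝ᵥ ((H - (1 + w ⬝ᵥ w)⁻¹ • vecMulVec v v) *ᵥ x)
        = (B *ᵥ x) ⬝ᵥ (B *ᵥ x) - (1 + w ⬝ᵥ w)⁻¹ * (w ⬝ᵥ (B *ᵥ x)) ^ 2 := by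
      rw [star_trivial, sub_mulVec, dotProduct_sub, hHx, smul_mulVec, dotProduct_smul,
        vecMulVec_mulVec, ← hvx]
      simp only [op_smul_eq_smul, dotProduct_smul, smul_eq_mul, dotProduct_comm x v]
      ring
    rw [hval, sub_pos, inv_mul_lt_iff₀ (by positivity)]
    linarith

/-- A sequence with positive definite Hankel matrix has a finite quadrature formula with a
prescribed node of positive weight. -/
theorem exists_quadrature_with_node (m : ℕ) (g : ℕ → ℝ)
    (hg : (Matrix.of fun p q : Fin (m + 1) => g ((p : ℕ) + (q : ℕ))).PosDef) (x₀ : ℝ) :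
    ∃ l w : Option (Fin (m + 1)) → ℝ, (∀ i, 0 ≤ w i) ∧ 0 < w none ∧ l none = x₀ ∧
      ∀ k ≤ 2 * m, g k = ∑ i, w i * l i ^ k := by
  obtain ⟨ε, hε, hpd⟩ := hg.exists_sub_smul_vecMulVec fun p => x₀ ^ (p : ℕ)
  obtain ⟨l, w, hw, hlw⟩ := exists_quadrature_of_hankel_posDef m (fun k => g k - ε * x₀ ^ k) (by
    convert hpd using 1
    ext p q
    simp [vecMulVec_apply, pow_add])
  refine ⟨fun i => i.elim x₀ l, fun i => i.elim ε w, ?_, hε, rfl, fun k hk => ?_⟩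
  · rintro (_ | i)
    exacts [hε.le, hw i]
  · rw [Fintype.sum_option]
    simp only [Option.elim]
    rw [← hlw k hk]
    ring

/-- Merge coinciding nodes and drop zero weights of a finite nonnegative combination. -/
theorem exists_finset_pos_weights {ι α : Type*} [Fintype ι] (P : ι → α)
    (w : ι → ℝ) (hw : ∀ i, 0 ≤ w i) :
    ∃ (t : Finset α) (c : α → ℝ), (∀ p ∈ t, 0 < c p) ∧ (∀ i, 0 < w i → P i ∈ t) ∧
      ∀ f : α → ℝ, ∑ p ∈ t, c p * f p = ∑ i, w i * f (P i) := by
  classical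
  set s : Finset ι := Finset.univ.filter fun i => 0 < w i with hs
  have hmem : ∀ i ∈ s, 0 < w i := fun i hi => (Finset.mem_filter.mp hi).2
  refine ⟨s.image P, fun p => ∑ i ∈ s.filter (P · = p), w i, fun p hp => ?_, fun i hi => ?_,
    fun f => ?_⟩
  · obtain ⟨i, hi, rfl⟩ := Finset.mem_image.mp hp
    exact Finset.sum_pos (fun j hj => hmem j (Finset.mem_filter.mp hj).1)
      ⟨i, Finset.mem_filter.mpr ⟨hi, rfl⟩⟩
  · exact Finset.mem_image_of_mem P (by simp [hs, hi])
  · have h1 : ∑ i, w i * f (P i) = ∑ i ∈ s, w i * f (P i) := by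
      refine (Finset.sum_subset (Finset.subset_univ s) fun i _ hi => ?_).symm
      have : w i = 0 := le_antisymm (by simpa [hs] using hi) (hw i)
      rw [this, zero_mul]
    rw [h1, ← Finset.sum_fiberwise_of_maps_to (fun i hi => Finset.mem_image_of_mem P hi)]
    refine Finset.sum_congr rfl fun p _ => ?_
    rw [Finset.sum_mul]
    refine Finset.sum_congr rfl fun i hi => ?_
    rw [(Finset.mem_filter.mp hi).2]

/-- A finitely atomic measure whose moments agree with `β` is a representing measure. -/
theorem isRepMeasure_sum_dirac {n : ℕ} {β : ℕ → ℕ → ℝ} (t : Finset (ℝ × ℝ)) (c : ℝ × ℝ → ℝ)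
    (hc : ∀ p ∈ t, 0 < c p)
    (h : ∀ i j : ℕ, i + j ≤ 2 * n → ∑ p ∈ t, c p * (p.1 ^ i * p.2 ^ j) = β i j) :
    IsRepMeasure n β (∑ p ∈ t, ENNReal.ofReal (c p) • Measure.dirac p) := by
  intro i j hij
  have hInt : ∀ q ∈ t, Integrable (fun p : ℝ × ℝ => p.1 ^ i * p.2 ^ j)
      (ENNReal.ofReal (c q) • Measure.dirac q) := fun q _ =>
    (integrable_dirac enorm_lt_top).smul_measure ENNReal.ofReal_ne_top
  refine ⟨integrable_finsetSum_measure.mpr hInt, ?_⟩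
  rw [integral_finsetSum_measure hInt, ← h i j hij]
  refine Finset.sum_congr rfl fun p hp => ?_
  rw [integral_smul_measure, integral_dirac, ENNReal.toReal_ofReal (hc p hp).le, smul_eq_mul]

/-- Under the `(y − x^d)` column relations, the moments of `β` are the core moments. -/
theorem coreGamma_eq {n d : ℕ} (hd : 1 ≤ d) {β : ℕ → ℕ → ℝ}
    (hrel : ∀ i j : ℕ, i + j + d ≤ 2 * n → β (i + d) j = β i (j + 1)) (A : ℕ → ℕ → ℝ)
    (i j : ℕ) (hij : i + j ≤ 2 * n) : coreGamma n d β A (i + d * j) = β i j := by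
  induction i using Nat.strong_induction_on generalizing j with
  | _ i ih =>
    by_cases hi : i < d
    · have h1 : (i + d * j) % d = i := by rw [Nat.add_mul_mod_self_left, Nat.mod_eq_of_lt hi]
      have h2 : (i + d * j) / d = j := by
        rw [Nat.add_mul_div_left _ _ (by omega), Nat.div_eq_of_lt hi, zero_add]
      rw [coreGamma, h1, h2, if_pos hij]
    · obtain ⟨k, rfl⟩ := Nat.exists_eq_add_of_le' (not_lt.mp hi)
      rw [hrel k j (by omega), ← ih k (by omega) (j + 1) (by omega)]
      congr 1
      ring

/-- A representing measure is supported in the curve given by the column relations. -/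
theorem IsRepMeasure.measure_ne_curve {n d : ℕ} (hd : 1 ≤ d) (hdn : d ≤ n) {β : ℕ → ℕ → ℝ}
    (hrel : ∀ i j : ℕ, i + j + d ≤ 2 * n → β (i + d) j = β i (j + 1)) {μ : Measure (ℝ × ℝ)}
    (hμ : IsRepMeasure n β μ) : μ {p : ℝ × ℝ | p.2 ≠ p.1 ^ d} = 0 := by
  obtain ⟨i1, e1⟩ := hμ 0 2 (by omega)
  obtain ⟨i2, e2⟩ := hμ d 1 (by omega)
  obtain ⟨i3, e3⟩ := hμ (d + d) 0 (by omega)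
  have hfun : (fun p : ℝ × ℝ => (p.2 - p.1 ^ d) ^ 2) = fun p =>
      p.1 ^ 0 * p.2 ^ 2 - 2 * (p.1 ^ d * p.2 ^ 1) + p.1 ^ (d + d) * p.2 ^ 0 := by
    ext p
    ring
  have hInt : Integrable (fun p : ℝ × ℝ => (p.2 - p.1 ^ d) ^ 2) μ := by
    rw [hfun]
    exact (i1.sub (i2.const_mul 2)).add i3
  have hzero : ∫ p : ℝ × ℝ, (p.2 - p.1 ^ d) ^ 2 ∂μ = 0 := by
    rw [hfun, integral_add (by exact i1.sub (i2.const_mul 2)) i3, integral_sub i1 (i2.const_mul 2),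
      integral_const_mul, e1, e2, e3, hrel d 0 (by omega)]
    have h := hrel 0 1 (by omega)
    rw [zero_add] at h
    rw [zero_add, h]
    ring
  have hae := (integral_eq_zero_iff_of_nonneg (fun p => sq_nonneg _) hInt).mp hzero
  refine measure_mono_null (fun p hp => ?_) (ae_iff.mp hae)
  simpa [sub_eq_zero] using hp

/-- If `M_n(β)` is positive semidefinite and `(y − x^d)`-pure and the core matrix
`C[A]` is positive definite for some choice of auxiliary moments `A`, then for
every `x₀ ∈ ℝ` there is a finitely atomic representing measure for `β` whose
(finite) support contains the point `(x₀, x₀^d)`; moreover every representing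
measure for `β` is supported in the curve `y = x^d`. -/
theorem pure_core_posDef_measures (n d : ℕ) (hd : 1 ≤ d) (hdn : d ≤ n)
    (β : ℕ → ℕ → ℝ) (hpure : IsPure n d β)
    (A : ℕ → ℕ → ℝ) (hC : (coreMatrix n d β A).PosDef) :
    (∀ x₀ : ℝ, ∃ (t : Finset (ℝ × ℝ)) (c : ℝ × ℝ → ℝ),
      (∀ p ∈ t, 0 < c p) ∧ (x₀, x₀ ^ d) ∈ t ∧
      IsRepMeasure n β (∑ p ∈ t, ENNReal.ofReal (c p) • Measure.dirac p)) ∧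
    (∀ μ : Measure (ℝ × ℝ), IsRepMeasure n β μ →
      μ {p : ℝ × ℝ | p.2 ≠ p.1 ^ d} = 0) := by
  obtain ⟨-, hrel, -, -⟩ := hpure
  refine ⟨fun x₀ => ?_, fun μ hμ => hμ.measure_ne_curve hd hdn hrel⟩
  obtain ⟨l, w, hw, hw0, hl0, hlw⟩ := exists_quadrature_with_node (n * d) (coreGamma n d β A) hC x₀
  obtain ⟨t, c, hc, ht, hsum⟩ := exists_finset_pos_weights (fun i => (l i, l i ^ d)) w hw
  refine ⟨t, c, hc, by simpa [hl0] using ht none hw0,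
    isRepMeasure_sum_dirac t c hc fun i j hij => ?_⟩
  have hdeg : i + d * j ≤ 2 * (n * d) := by nlinarith
  rw [hsum fun p => p.1 ^ i * p.2 ^ j, ← coreGamma_eq hd hrel A i j hij, hlw _ hdeg]
  refine Finset.sum_congr rfl fun k _ => ?_
  rw [pow_add, pow_mul]
end
end

section
/- Let n ≥ d ≥ 1 be integers and let β be a bivariate sequence of degree 2n that satisfies the (y−x^d) column relations. Let S := {m ∈ ℤ : 0 ≤ m ≤ nd and (m mod d) + ⌊m/d⌋ ≤ n}. Then: (a) for all p, q ∈ S, β_{(p+q) mod d, ⌊(p+q)/d⌋} = β_{(p mod d)+(q mod d), ⌊p/d⌋+⌊q/d⌋}; (b) the map m ↦ (m mod d, ⌊m/d⌋) is a bijection from S onto {(i,j) : 0 ≤ i ≤ d−1, j ≥ 0, i+j ≤ n}, under which the matrix Ĉ := (β_{(p+q) mod d, ⌊(p+q)/d⌋})_{p,q ∈ S} is carried to the compressed moment matrix M̂_n(β); in particular, Ĉ is positive definite if and only if M̂_n(β) is positive definite. -/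
open MeasureTheory Matrix

noncomputable section

/-- Index set `S = {m : 0 ≤ m ≤ nd, (m mod d) + ⌊m/d⌋ ≤ n}`. -/
abbrev SIdx (n d : ℕ) : Type :=
  {m : Fin (n * d + 1) // (m : ℕ) % d + (m : ℕ) / d ≤ n}

/-- The compressed core matrix `Ĉ = (β_{(p+q) mod d, ⌊(p+q)/d⌋})_{p,q ∈ S}`. -/
def hatCore (n d : ℕ) (β : ℕ → ℕ → ℝ) : Matrix (SIdx n d) (SIdx n d) ℝ :=
  Matrix.of fun p q =>
    β (((p.1 : ℕ) + (q.1 : ℕ)) % d) (((p.1 : ℕ) + (q.1 : ℕ)) / d)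

/-- Adding `p` and `q` in base `d` produces at most one carry, which a `(y − x^d)` column relation
absorbs. -/
lemma beta_add_mod_div {n d : ℕ} (hd : 1 ≤ d) {β : ℕ → ℕ → ℝ}
    (hcol : ∀ i j : ℕ, i + j + d ≤ 2 * n → β (i + d) j = β i (j + 1)) {p q : ℕ}
    (hp : p % d + p / d ≤ n) (hq : q % d + q / d ≤ n) :
    β ((p + q) % d) ((p + q) / d) = β (p % d + q % d) (p / d + q / d) := by
  rw [Nat.add_div hd]
  split_ifs with h
  · have hmod := Nat.add_mod_add_of_le_add_mod h
    rw [← hcol _ _ (by omega), hmod]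
  · rw [Nat.add_mod_of_add_mod_lt (not_le.mp h), add_zero]

/-- The exponent `i + d * j` of `x` in `x^i y^j` on the curve `y = x^d` is at most `n * d`. -/
lemma add_mul_le_mul_of_add_le {n d i j : ℕ} (hd : 1 ≤ d) (hij : i + j ≤ n) :
    i + d * j ≤ n * d := by
  calc i + d * j ≤ d * i + d * j := by gcongr; exact Nat.le_mul_of_pos_left i hd
    _ = (i + j) * d := by ring
    _ ≤ n * d := by gcongr

lemma add_mul_mod_div {d i : ℕ} (hi : i < d) (j : ℕ) :
    (i + d * j) % d = i ∧ (i + d * j) / d = j := by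
  constructor
  · rw [Nat.add_mul_mod_self_left, Nat.mod_eq_of_lt hi]
  · rw [Nat.add_mul_div_left _ _ (by omega), Nat.div_eq_of_lt hi, zero_add]

/-- Quotient and remainder by `d`, as an equivalence between the index sets of the compressed core
matrix and of the compressed moment matrix. -/
def modDivEquiv (n d : ℕ) (hd : 1 ≤ d) : SIdx n d ≃ MomIdxHat n d where
  toFun m := ⟨(⟨m.1 % d, Nat.lt_succ_of_le ((Nat.le_add_right _ _).trans m.2)⟩,
      ⟨m.1 / d, Nat.lt_succ_of_le ((Nat.le_add_left _ _).trans m.2)⟩),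
    m.2, Nat.mod_lt _ hd⟩
  invFun p := ⟨⟨p.1.1 + d * p.1.2, Nat.lt_succ_of_le (add_mul_le_mul_of_add_le hd p.2.1)⟩, by
    obtain ⟨hmod, hdiv⟩ := add_mul_mod_div p.2.2 p.1.2
    simpa only [hmod, hdiv] using p.2.1⟩
  left_inv m := Subtype.ext (Fin.ext (Nat.mod_add_div _ _))
  right_inv p := by
    obtain ⟨hmod, hdiv⟩ := add_mul_mod_div p.2.2 p.1.2
    exact Subtype.ext (Prod.ext (Fin.ext hmod) (Fin.ext hdiv))

/-- The compressed core matrix `Ĉ` is (orthogonally) equivalent to the compressed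
moment matrix `M̂_n(β)`: (a) for `p, q ∈ S`,
`β_{(p+q) mod d, ⌊(p+q)/d⌋} = β_{(p mod d)+(q mod d), ⌊p/d⌋+⌊q/d⌋}`;
(b) `m ↦ (m mod d, ⌊m/d⌋)` is a bijection from `S` onto
`{(i,j) : i ≤ d−1, i+j ≤ n}`, carrying `Ĉ` to `M̂_n(β)`; in particular
`Ĉ` is positive definite iff `M̂_n(β)` is. -/
theorem hatCore_equiv_hatMoment (n d : ℕ) (hd : 1 ≤ d) (hdn : d ≤ n)
    (β : ℕ → ℕ → ℝ) (hβ00 : β 0 0 = 1)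
    (hcol : ∀ i j : ℕ, i + j + d ≤ 2 * n → β (i + d) j = β i (j + 1)) :
    (∀ p q : ℕ, p ≤ n * d → q ≤ n * d → p % d + p / d ≤ n → q % d + q / d ≤ n →
      β ((p + q) % d) ((p + q) / d) = β (p % d + q % d) (p / d + q / d)) ∧
    Set.BijOn (fun m : ℕ => (m % d, m / d))
      {m : ℕ | m ≤ n * d ∧ m % d + m / d ≤ n}
      {p : ℕ × ℕ | p.1 < d ∧ p.1 + p.2 ≤ n} ∧
    ∃ e : SIdx n d ≃ MomIdxHat n d,
      (∀ m : SIdx n d,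
        (((e m).1.1 : ℕ) = (m.1 : ℕ) % d ∧ ((e m).1.2 : ℕ) = (m.1 : ℕ) / d)) ∧
      (∀ p q : SIdx n d, hatCore n d β p q = momentMatrixHat n d β (e p) (e q)) ∧
      ((hatCore n d β).PosDef ↔ (momentMatrixHat n d β).PosDef) := by
  have hcarry : ∀ p q : SIdx n d, hatCore n d β p q =
      momentMatrixHat n d β (modDivEquiv n d hd p) (modDivEquiv n d hd q) :=
    fun p q => beta_add_mod_div hd hcol p.2 q.2
  refine ⟨fun p q _ _ hp hq => beta_add_mod_div hd hcol hp hq, ⟨?_, ?_, ?_⟩,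
    modDivEquiv n d hd, fun m => ⟨rfl, rfl⟩, hcarry, ?_⟩
  · exact fun m hm => ⟨Nat.mod_lt _ hd, hm.2⟩
  · intro a _ b _ hab
    obtain ⟨hmod, hdiv⟩ := Prod.mk.inj hab
    rw [← Nat.mod_add_div a d, hmod, hdiv, Nat.mod_add_div]
  · rintro ⟨i, j⟩ ⟨hi, hij⟩
    obtain ⟨hmod, hdiv⟩ := add_mul_mod_div hi j
    exact ⟨i + d * j, ⟨add_mul_le_mul_of_add_le hd hij, by rwa [hmod, hdiv]⟩,
      Prod.ext hmod hdiv⟩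
  · have hsub : hatCore n d β = (momentMatrixHat n d β).submatrix (modDivEquiv n d hd)
        (modDivEquiv n d hd) := Matrix.ext hcarry
    rw [hsub]
    refine ⟨fun h => ?_, fun h => h.submatrix (modDivEquiv n d hd).injective⟩
    simpa using h.submatrix (modDivEquiv n d hd).symm.injective
end
end

section
/- Fix integers n ≥ d ≥ 1. Let (h_p)_{0 ≤ p ≤ 2nd} be real numbers with h_0 = 1, let S := {m ∈ ℤ : 0 ≤ m ≤ nd and (m mod d) + ⌊m/d⌋ ≤ n}, and suppose the matrix Ĥ := (h_{p+q})_{p,q ∈ S} is positive definite. Define β_{ij} := h_{i+dj} for all integers i,j ≥ 0 with i+j ≤ 2n. Then β is a bivariate sequence of degree 2n that satisfies the (y−x^d) column relations, M_n(β) is positive semidefinite, and M̂_n(β) is positive definite (so M_n(β) is positive semidefinite and (y−x^d)-pure). Moreover, β is the unique bivariate sequence of degree 2n satisfying the (y−x^d) column relations for which β_{(p+q) mod d, ⌊(p+q)/d⌋} = h_{p+q} for all p, q ∈ S. -/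
open MeasureTheory Matrix

noncomputable section

/-- The image `i + d * j` of a monomial index `(i, j)` with `i + j ≤ n` belongs to `S`. -/
def SIdx.ofPair (n d : ℕ) (hd : 1 ≤ d) (i j : ℕ) (hij : i + j ≤ n) : SIdx n d :=
  ⟨⟨i + d * j, Nat.lt_succ_of_le (by nlinarith)⟩, by
    have h1 := Nat.mod_add_div i d
    have h2 : i / d ≤ d * (i / d) := Nat.le_mul_of_pos_left _ hd
    simp only [Nat.add_mul_mod_self_left, Nat.add_mul_div_left _ _ hd]
    omega⟩

/-- Iterating the `(y − x^d)` column relations. -/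
lemma columnRelation_iterate {n d : ℕ} (hd : 1 ≤ d) {β : ℕ → ℕ → ℝ}
    (hβ : ∀ i j : ℕ, i + j + d ≤ 2 * n → β (i + d) j = β i (j + 1)) (i k : ℕ) :
    ∀ j : ℕ, i + d * k + j ≤ 2 * n → β (i + d * k) j = β i (k + j) := by
  induction k with
  | zero => intro j _; simp
  | succ k ih =>
    intro j hj
    rw [Nat.mul_succ] at hj ⊢
    rw [← add_assoc, hβ _ _ (by omega), ih _ (by omega)]
    congr 1
    omega

/-- Positive definite central compressions of Hankel `(nd+1)×(nd+1)` matrices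
determine positive semidefinite `(y − x^d)`-pure moment matrices: if
`Ĥ = (h_{p+q})_{p,q ∈ S}` is positive definite (and `h_0 = 1`), then
`β_{ij} := h_{i+dj}` is a bivariate sequence of degree `2n` satisfying the
`(y−x^d)` column relations with `M_n(β)` positive semidefinite and `M̂_n(β)`
positive definite; moreover `β` is the unique such sequence with
`β_{(p+q) mod d, ⌊(p+q)/d⌋} = h_{p+q}` for all `p, q ∈ S`. -/
theorem hankel_compression_to_pure (n d : ℕ) (hd : 1 ≤ d) (hdn : d ≤ n)
    (h : ℕ → ℝ) (h0 : h 0 = 1)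
    (hH : (Matrix.of fun p q : SIdx n d =>
      h ((p.1 : ℕ) + (q.1 : ℕ))).PosDef) :
    IsPure n d (fun i j => h (i + d * j)) ∧
    ∀ β' : ℕ → ℕ → ℝ, β' 0 0 = 1 →
      (∀ i j : ℕ, i + j + d ≤ 2 * n → β' (i + d) j = β' i (j + 1)) →
      (∀ p q : SIdx n d,
        β' (((p.1 : ℕ) + (q.1 : ℕ)) % d) (((p.1 : ℕ) + (q.1 : ℕ)) / d) =
          h ((p.1 : ℕ) + (q.1 : ℕ))) →
      ∀ i j : ℕ, i + j ≤ 2 * n → β' i j = h (i + d * j) := by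
  refine ⟨⟨by simpa using h0, fun i j _ => congrArg h (by ring), ?_, ?_⟩, ?_⟩
  · convert hH.posSemidef.submatrix
      (fun p : MomIdx n => SIdx.ofPair n d hd p.1.1 p.1.2 p.2) using 1
    ext p q
    simp only [momentMatrix, Matrix.of_apply, Matrix.submatrix_apply, SIdx.ofPair]
    congr 1
    ring
  · have hinj : Function.Injective
        (fun p : MomIdxHat n d => SIdx.ofPair n d hd p.1.1 p.1.2 p.2.1) := by
      rintro ⟨⟨i, j⟩, _, hi⟩ ⟨⟨k, l⟩, _, hk⟩ hpq
      have hval : (i : ℕ) + d * j = k + d * l := congrArg (fun s : SIdx n d => (s.1 : ℕ)) hpq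
      have hik : (i : ℕ) = k := by
        simpa [Nat.mod_eq_of_lt hi, Nat.mod_eq_of_lt hk] using congrArg (· % d) hval
      have hjl : (j : ℕ) = l := Nat.eq_of_mul_eq_mul_left hd (by omega)
      simp [Fin.ext_iff, hik, hjl]
    convert hH.submatrix hinj using 1
    ext p q
    simp only [momentMatrixHat, Matrix.of_apply, Matrix.submatrix_apply, SIdx.ofPair]
    congr 1
    ring
  · intro β' _ hrel hdata i j hij
    obtain ⟨i₁, i₂, j₁, j₂, rfl, rfl, h₁, h₂⟩ : ∃ i₁ i₂ j₁ j₂ : ℕ,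
        i = i₁ + i₂ ∧ j = j₁ + j₂ ∧ i₁ + j₁ ≤ n ∧ i₂ + j₂ ≤ n :=
      ⟨min i n, i - min i n, min j (n - min i n), j - min j (n - min i n),
        by omega, by omega, by omega, by omega⟩
    have key := hdata (SIdx.ofPair n d hd i₁ j₁ h₁) (SIdx.ofPair n d hd i₂ j₂ h₂)
    have hsum : i₁ + d * j₁ + (i₂ + d * j₂) = i₁ + i₂ + d * (j₁ + j₂) := by ring
    simp only [SIdx.ofPair, hsum, Nat.add_mul_mod_self_left, Nat.add_mul_div_left _ _ hd] at key
    have hred := columnRelation_iterate hd hrel ((i₁ + i₂) % d) ((i₁ + i₂) / d) (j₁ + j₂)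
      (by rwa [Nat.mod_add_div])
    rw [Nat.mod_add_div] at hred
    rw [hred, key]
end
end

section
/- Let n ≥ 3 be an integer and let β be a bivariate sequence of degree 2n such that M_n(β) is positive semidefinite and (y−x³)-pure (take d = 3). For 0 ≤ p ≤ 6n−2 set γ_p := β_{p mod 3, ⌊p/3⌋} (for these p one has (p mod 3) + ⌊p/3⌋ ≤ 2n, so γ_p involves only genuine moments of β). Then β admits a representing measure if and only if the determinant of the 3n×3n Hankel matrix (γ_{p+q})_{0 ≤ p,q ≤ 3n−1} is strictly positive. -/
open MeasureTheory Matrix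

noncomputable section

/-- For `d = 3`: the univariate sequence `γ_p = β_{p mod 3, ⌊p/3⌋}`. -/
def gamma3 (β : ℕ → ℕ → ℝ) (p : ℕ) : ℝ := β (p % 3) (p / 3)

/-- The `m × m` Hankel matrix of the sequence `g`. -/
def hankelMatrix (g : ℕ → ℝ) (m : ℕ) : Matrix (Fin m) (Fin m) ℝ :=
  Matrix.of fun p q => g ((p : ℕ) + (q : ℕ))

lemma hankelMatrix_isSymm (g : ℕ → ℝ) (m : ℕ) : (hankelMatrix g m)ᵀ = hankelMatrix g m := by
  ext i j
  simp [hankelMatrix, add_comm]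

lemma exists_sum_pow_eq_dotProduct_pow_mulVec {ι : Type*} [Fintype ι] [DecidableEq ι]
    {A : Matrix ι ι ℝ} (hA : A.IsHermitian) (u : ι → ℝ) :
    ∃ x w : ι → ℝ, (∀ i, 0 ≤ w i) ∧ ∀ p : ℕ, ∑ i, w i * x i ^ p = u ⬝ᵥ (A ^ p *ᵥ u) := by
  let U := (hA.eigenvectorUnitary : Matrix ι ι ℝ)
  refine ⟨hA.eigenvalues, fun i => (Uᵀ *ᵥ u) i ^ 2, fun i => sq_nonneg _, fun p => ?_⟩
  have hpow : A ^ p = U * diagonal (fun i => hA.eigenvalues i ^ p) * Uᵀ := by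
    conv_lhs => rw [hA.spectral_theorem, ← map_pow, diagonal_pow]
    rw [Unitary.conjStarAlgAut_apply]
    rfl
  rw [hpow, ← mulVec_mulVec, ← mulVec_mulVec, dotProduct_mulVec, ← mulVec_transpose]
  simp only [dotProduct, mulVec_diagonal]
  exact Finset.sum_congr rfl fun i _ => by ring

lemma Matrix.PosDef.exists_transpose_mul_self {ι : Type*} [Fintype ι] [DecidableEq ι]
    {H : Matrix ι ι ℝ} (hH : H.PosDef) : ∃ B : Matrix ι ι ℝ, IsUnit B.det ∧ H = Bᵀ * B := by
  open scoped MatrixOrder in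
  obtain ⟨B, hB⟩ := CStarAlgebra.nonneg_iff_eq_star_mul_self.1 (nonneg_iff_posSemidef.2 hH.posSemidef)
  rw [star_eq_conjTranspose, conjTranspose_eq_transpose_of_trivial] at hB
  refine ⟨B, isUnit_iff_ne_zero.2 fun h => hH.det_pos.ne' ?_, hB⟩
  rw [hB, det_mul, h, mul_zero]

/-- Truncated Hamburger moment problem with positive definite Hankel matrix. -/
lemma exists_atoms_of_hankelMatrix_posDef (g : ℕ → ℝ) (N : ℕ)
    (hH : (hankelMatrix g (N + 1)).PosDef) (v : Fin (N + 1) → ℝ)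
    (hv : ∀ j, (hankelMatrix g (N + 1) *ᵥ v) j = g (N + 1 + j)) :
    ∃ x w : Fin (N + 1) → ℝ, (∀ i, 0 ≤ w i) ∧
      (∀ p ≤ 2 * N + 1, ∑ i, w i * x i ^ p = g p) ∧
      ∑ i, w i * x i ^ (2 * N + 2) = v ⬝ᵥ (hankelMatrix g (N + 1) *ᵥ v) := by
  obtain ⟨B, hB, hHB⟩ := hH.exists_transpose_mul_self
  set H := hankelMatrix g (N + 1) with hHdef
  let K : Matrix (Fin (N + 1)) (Fin (N + 1)) ℝ := hankelMatrix (fun p => g (p + 1)) (N + 1)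
  let A := (B⁻¹)ᵀ * K * B⁻¹
  have hBt : Bᵀ * (B⁻¹)ᵀ = 1 := by rw [← transpose_mul, nonsing_inv_mul _ hB, transpose_one]
  have hAt : Aᵀ = A := by
    simp only [A, K, transpose_mul, transpose_transpose, hankelMatrix_isSymm, Matrix.mul_assoc]
  have hA : A.IsHermitian := by
    rw [IsHermitian, conjTranspose_eq_transpose_of_trivial, hAt]
  have hKA : Bᵀ * (A * B) = K := by
    simp only [A]
    rw [Matrix.mul_assoc _ B⁻¹ B, nonsing_inv_mul _ hB, Matrix.mul_one, ← Matrix.mul_assoc, hBt,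
      Matrix.one_mul]
  have hshift : ∀ y z, K *ᵥ y = H *ᵥ z → A *ᵥ (B *ᵥ y) = B *ᵥ z := by
    intro y z h
    have hBt' : (B⁻¹)ᵀ * Bᵀ = 1 := by rw [← transpose_mul, mul_nonsing_inv _ hB, transpose_one]
    rw [← hKA, hHB, ← mulVec_mulVec y Bᵀ, ← mulVec_mulVec z Bᵀ] at h
    have h' := congrArg ((B⁻¹)ᵀ *ᵥ ·) h
    rwa [mulVec_mulVec _ (B⁻¹)ᵀ Bᵀ, mulVec_mulVec _ (B⁻¹)ᵀ Bᵀ, hBt', one_mulVec, one_mulVec,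
      ← mulVec_mulVec] at h'
  let e : Fin (N + 1) → Fin (N + 1) → ℝ := fun k => Pi.single k 1
  have hdot : ∀ y z, (B *ᵥ y) ⬝ᵥ (B *ᵥ z) = y ⬝ᵥ (H *ᵥ z) := by
    intro y z
    rw [hHB, ← mulVec_mulVec, dotProduct_mulVec y, vecMul_transpose]
  have hpow : ∀ k (hk : k < N + 1), A ^ k *ᵥ (B *ᵥ e 0) = B *ᵥ e ⟨k, hk⟩ := by
    intro k
    induction k with
    | zero => intro hk; simp
    | succ k ih =>
      intro hk
      rw [pow_succ', ← mulVec_mulVec, ih (by omega)]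
      apply hshift
      ext i
      simp only [e, mulVec_single_one, K, H, hankelMatrix, col_apply, of_apply]
      congr 1
  have hlast : A ^ (N + 1) *ᵥ (B *ᵥ e 0) = B *ᵥ v := by
    rw [pow_succ', ← mulVec_mulVec, hpow N (by omega)]
    apply hshift
    ext i
    rw [hv]
    simp only [e, mulVec_single_one, K, hankelMatrix, col_apply, of_apply]
    congr 1
    omega
  have hadd : ∀ k l, (B *ᵥ e 0) ⬝ᵥ (A ^ (k + l) *ᵥ (B *ᵥ e 0)) =
      (A ^ k *ᵥ (B *ᵥ e 0)) ⬝ᵥ (A ^ l *ᵥ (B *ᵥ e 0)) := by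
    intro k l
    rw [pow_add, ← mulVec_mulVec, dotProduct_mulVec, ← mulVec_transpose, transpose_pow, hAt]
  obtain ⟨x, w, hw, hxw⟩ := exists_sum_pow_eq_dotProduct_pow_mulVec hA (B *ᵥ e 0)
  refine ⟨x, w, hw, fun p hp => ?_, ?_⟩
  · rw [hxw]
    rcases Nat.lt_or_ge p (N + 1) with h | h
    · rw [← zero_add p, hadd, hpow p h, hpow 0 (by omega), hdot]
      simp [e, H, hankelMatrix]
    · obtain ⟨l, rfl⟩ := Nat.exists_eq_add_of_le h
      rw [add_comm (N + 1) l, hadd, hpow l (by omega), hlast, hdot]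
      simp [e, hv, add_comm]
  · rw [hxw, show 2 * N + 2 = (N + 1) + (N + 1) by ring, hadd, hlast, hdot]

lemma Matrix.posDef_of_submatrix_castSucc_of_det_pos {N : ℕ}
    {M : Matrix (Fin (N + 1)) (Fin (N + 1)) ℝ} (hM : M.IsHermitian)
    (h : (M.submatrix Fin.castSucc Fin.castSucc).PosDef) (hd : 0 < M.det) : M.PosDef := by
  set A := M.submatrix Fin.castSucc Fin.castSucc with hA
  let B : Matrix (Fin N) (Fin 1) ℝ := Matrix.of fun i _ => M i.castSucc (Fin.last N)
  let D : Matrix (Fin 1) (Fin 1) ℝ := Matrix.of fun _ _ => M (Fin.last N) (Fin.last N)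
  have hsub : M.submatrix (finSumFinEquiv (m := N) (n := 1)) finSumFinEquiv =
      fromBlocks A B Bᴴ D := by
    ext i j
    rcases i with i | i <;> rcases j with j | j
    · rfl
    · rw [Subsingleton.elim j 0]; rfl
    · rw [Subsingleton.elim i 0]; exact (hM.apply _ _).symm
    · rw [Subsingleton.elim j 0, Subsingleton.elim i 0]; rfl
  have hdet : M.det = A.det * (D - Bᴴ * A⁻¹ * B).det := by
    have := h.isUnit.invertible
    rw [← det_submatrix_equiv_self (finSumFinEquiv (m := N) (n := 1)) M, hsub, det_fromBlocks₁₁,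
      invOf_eq_nonsing_inv]
  have hS : (D - Bᴴ * A⁻¹ * B).PosSemidef := by
    have hpos : 0 < (D - Bᴴ * A⁻¹ * B).det := by
      rw [hdet] at hd
      exact (pos_iff_pos_of_mul_pos hd).1 h.det_pos
    rw [det_unique] at hpos
    have : D - Bᴴ * A⁻¹ * B = diagonal fun i => (D - Bᴴ * A⁻¹ * B) i i := by
      ext i j
      rw [Subsingleton.elim i j, diagonal_apply_eq]
    rw [this, posSemidef_diagonal_iff]
    intro i
    rw [Subsingleton.elim i default]
    exact hpos.le
  have hMs : M.PosSemidef := by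
    have := h.isUnit.invertible
    rw [← posSemidef_submatrix_equiv (finSumFinEquiv (m := N) (n := 1)), hsub]
    exact (h.fromBlocks₁₁ B D).2 hS
  exact hMs.posDef_iff_det_ne_zero.2 hd.ne'

lemma Matrix.PosDef.exists_dotProduct_mulVec_eq {ι : Type*} [Fintype ι] [DecidableEq ι]
    {H : Matrix ι ι ℝ} (hH : H.PosDef) {i₀ : ι} {a : ι → ℝ} (ha : a i₀ = 0) {q : ℝ}
    (hq : a ⬝ᵥ (H *ᵥ a) ≤ q) :
    ∃ v : ι → ℝ, (∀ j, j ≠ i₀ → (H *ᵥ v) j = (H *ᵥ a) j) ∧ v ⬝ᵥ (H *ᵥ v) = q := by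
  let w := H⁻¹ *ᵥ Pi.single i₀ 1
  have hw : H *ᵥ w = Pi.single i₀ 1 := by
    simp only [w]
    rw [mulVec_mulVec, mul_nonsing_inv _ ((isUnit_iff_isUnit_det H).1 hH.isUnit), one_mulVec]
  have hwH : ∀ z, w ⬝ᵥ (H *ᵥ z) = z i₀ := by
    intro z
    have hsymm : Hᵀ = H := by
      rw [← conjTranspose_eq_transpose_of_trivial]; exact hH.1
    rw [dotProduct_mulVec, ← mulVec_transpose, hsymm, hw, single_one_dotProduct]
  have hw0 : w ≠ 0 := by
    intro h
    rw [h, mulVec_zero] at hw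
    simpa using congrFun hw i₀
  have hpos : 0 < w i₀ := by
    have := hH.dotProduct_mulVec_pos hw0
    rwa [star_trivial, hwH] at this
  let s := √((q - a ⬝ᵥ (H *ᵥ a)) / w i₀)
  have hs : s ^ 2 * w i₀ = q - a ⬝ᵥ (H *ᵥ a) := by
    rw [Real.sq_sqrt (div_nonneg (sub_nonneg.2 hq) hpos.le), div_mul_cancel₀ _ hpos.ne']
  refine ⟨a + s • w, fun j hj => ?_, ?_⟩
  · simp [mulVec_add, mulVec_smul, hw, hj]
  · have haw : a ⬝ᵥ (H *ᵥ w) = 0 := by rw [hw, dotProduct_single_one, ha]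
    simp only [mulVec_add, mulVec_smul, add_dotProduct, dotProduct_add, smul_dotProduct,
      dotProduct_smul, hwH, haw, ha, smul_eq_mul]
    linear_combination hs

lemma gamma3_add_three_mul {n : ℕ} {β : ℕ → ℕ → ℝ}
    (hβ : ∀ i j : ℕ, i + j + 3 ≤ 2 * n → β (i + 3) j = β i (j + 1)) :
    ∀ i j : ℕ, i + j ≤ 2 * n → gamma3 β (i + 3 * j) = β i j := by
  intro i
  induction i using Nat.strong_induction_on with
  | _ i ih =>
    intro j hij
    rcases Nat.lt_or_ge i 3 with hi | hi
    · rw [gamma3]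
      congr 1 <;> omega
    · obtain ⟨k, rfl⟩ := Nat.exists_eq_add_of_le' hi
      rw [hβ k j (by omega), ← ih k (by omega) (j + 1) (by omega)]
      congr 1
      ring

/-- The exponents `0, …, N - 1, N + 1`. -/
def gapExp (N : ℕ) (k : Fin (N + 1)) : ℕ := if (k : ℕ) < N then k else N + 1

@[simp] lemma gapExp_castSucc {N : ℕ} (k : Fin N) : gapExp N k.castSucc = k := by simp [gapExp]

@[simp] lemma gapExp_last (N : ℕ) : gapExp N (Fin.last N) = N + 1 := by simp [gapExp]

lemma posDef_gapExp {n N : ℕ} (hn : 3 ≤ n) (hN : 3 * n = N + 1) {β : ℕ → ℕ → ℝ}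
    (hβ : ∀ i j : ℕ, i + j + 3 ≤ 2 * n → β (i + 3) j = β i (j + 1))
    (h : (momentMatrixHat n 3 β).PosDef) :
    (Matrix.of fun p q => gamma3 β (gapExp N p + gapExp N q)).PosDef := by
  let f : Fin (N + 1) → MomIdxHat n 3 := fun k =>
    ⟨(⟨gapExp N k % 3, by omega⟩, ⟨gapExp N k / 3, by unfold gapExp; split_ifs <;> omega⟩),
      by dsimp only; unfold gapExp; split_ifs <;> omega, by dsimp only; omega⟩
  have hf : Function.Injective f := by
    intro k l hkl
    have h1 : gapExp N k % 3 = gapExp N l % 3 := congrArg (fun z => (z.1.1 : ℕ)) hkl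
    have h2 : gapExp N k / 3 = gapExp N l / 3 := congrArg (fun z => (z.1.2 : ℕ)) hkl
    have h3 : gapExp N k = gapExp N l := by omega
    unfold gapExp at h3
    ext
    split_ifs at h3 <;> omega
  convert h.submatrix hf using 1
  ext k l
  simp only [of_apply, momentMatrixHat, submatrix_apply, f]
  rw [← gamma3_add_three_mul hβ]
  · congr 1
    omega
  · have hk := (f k).2.1
    have hl := (f l).2.1
    simp only [f] at hk hl
    omega

lemma Polynomial.eval_eq_sum_gapExp {N : ℕ} {P : Polynomial ℝ} (hP : P.natDegree ≤ N + 1)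
    (h0 : P.coeff N = 0) (x : ℝ) :
    ∑ k, P.coeff (gapExp N k) * x ^ gapExp N k = P.eval x := by
  rw [Polynomial.eval_eq_sum_range' (Nat.lt_succ_of_le hP), Finset.sum_range_succ,
    Finset.sum_range_succ, h0, zero_mul, add_zero, Fin.sum_univ_castSucc, Finset.sum_range]
  simp

lemma IsRepMeasure.ae_eq_pow_three {n : ℕ} (hn : 3 ≤ n) {β : ℕ → ℕ → ℝ}
    (hβ : ∀ i j : ℕ, i + j + 3 ≤ 2 * n → β (i + 3) j = β i (j + 1))
    {μ : Measure (ℝ × ℝ)} (hμ : IsRepMeasure n β μ) : ∀ᵐ z ∂μ, z.2 = z.1 ^ 3 := by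
  obtain ⟨i1, h1⟩ := hμ 0 2 (by omega)
  obtain ⟨i2, h2⟩ := hμ 3 1 (by omega)
  obtain ⟨i3, h3⟩ := hμ 6 0 (by omega)
  have e : (fun z : ℝ × ℝ => (z.2 - z.1 ^ 3) ^ 2) = fun z =>
      z.1 ^ 0 * z.2 ^ 2 - 2 * (z.1 ^ 3 * z.2 ^ 1) + z.1 ^ 6 * z.2 ^ 0 := by
    ext z; ring
  have i12 : Integrable (fun z : ℝ × ℝ => z.1 ^ 0 * z.2 ^ 2 - 2 * (z.1 ^ 3 * z.2 ^ 1)) μ :=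
    i1.sub (i2.const_mul 2)
  have hintg : Integrable (fun z : ℝ × ℝ => (z.2 - z.1 ^ 3) ^ 2) μ := by
    rw [e]
    exact i12.add i3
  have h0 : ∫ z : ℝ × ℝ, (z.2 - z.1 ^ 3) ^ 2 ∂μ = 0 := by
    rw [e, integral_add i12 i3, integral_sub i1 (i2.const_mul 2),
      integral_const_mul, h1, h2, h3, hβ 3 0 (by omega), hβ 0 1 (by omega)]
    ring
  filter_upwards [(integral_eq_zero_iff_of_nonneg (fun z => sq_nonneg _) hintg).1 h0] with z hz
  exact sub_eq_zero.1 (pow_eq_zero_iff two_ne_zero |>.1 hz)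

lemma IsRepMeasure.integral_pow_fst {n : ℕ} (hn : 3 ≤ n) {β : ℕ → ℕ → ℝ}
    (hβ : ∀ i j : ℕ, i + j + 3 ≤ 2 * n → β (i + 3) j = β i (j + 1))
    {μ : Measure (ℝ × ℝ)} (hμ : IsRepMeasure n β μ) {p : ℕ} (hp : p % 3 + p / 3 ≤ 2 * n) :
    Integrable (fun z : ℝ × ℝ => z.1 ^ p) μ ∧ ∫ z : ℝ × ℝ, z.1 ^ p ∂μ = gamma3 β p := by
  have hae : (fun z : ℝ × ℝ => z.1 ^ (p % 3) * z.2 ^ (p / 3)) =ᵐ[μ] fun z => z.1 ^ p := by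
    filter_upwards [hμ.ae_eq_pow_three hn hβ] with z hz
    rw [hz, ← pow_mul, ← pow_add, Nat.mod_add_div]
  obtain ⟨hi, h⟩ := hμ _ _ hp
  exact ⟨hi.congr hae, by rw [← integral_congr_ae hae, h]; rfl⟩

lemma dotProduct_mulVec_eq_integral_sq {ι : Type*} [Fintype ι] {μ : Measure (ℝ × ℝ)}
    {g : ℕ → ℝ} {e : ι → ℕ}
    (h : ∀ i j, Integrable (fun z : ℝ × ℝ => z.1 ^ (e i + e j)) μ ∧
      ∫ z : ℝ × ℝ, z.1 ^ (e i + e j) ∂μ = g (e i + e j)) (c : ι → ℝ) :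
    Integrable (fun z : ℝ × ℝ => (∑ i, c i * z.1 ^ e i) ^ 2) μ ∧
      ∫ z : ℝ × ℝ, (∑ i, c i * z.1 ^ e i) ^ 2 ∂μ =
        c ⬝ᵥ (Matrix.of (fun i j => g (e i + e j)) *ᵥ c) := by
  have hsq : (fun z : ℝ × ℝ => (∑ i, c i * z.1 ^ e i) ^ 2) = fun z =>
      ∑ i, ∑ j, c i * c j * z.1 ^ (e i + e j) := by
    ext z
    rw [sq, Finset.sum_mul_sum]
    refine Finset.sum_congr rfl fun i _ => Finset.sum_congr rfl fun j _ => ?_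
    ring
  have hintg : ∀ i j, Integrable (fun z : ℝ × ℝ => c i * c j * z.1 ^ (e i + e j)) μ :=
    fun i j => (h i j).1.const_mul _
  rw [hsq]
  refine ⟨integrable_finsetSum _ fun i _ => integrable_finsetSum _ fun j _ => hintg i j, ?_⟩
  rw [integral_finsetSum _ fun i _ => integrable_finsetSum _ fun j _ => hintg i j]
  simp only [dotProduct, mulVec, of_apply, Finset.mul_sum]
  refine Finset.sum_congr rfl fun i _ => ?_
  rw [integral_finsetSum _ fun j _ => hintg i j]
  refine Finset.sum_congr rfl fun j _ => ?_
  rw [integral_const_mul, (h i j).2]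
  ring

lemma hankelMatrix_posDef_of_gapExp {N : ℕ} {g : ℕ → ℝ}
    (h : (Matrix.of fun p q => g (gapExp N p + gapExp N q)).PosDef) :
    (hankelMatrix g N).PosDef := by
  convert h.submatrix (Fin.castSucc_injective N) using 1
  ext i j
  simp [hankelMatrix]

/-- A least squares vector supported on the first `N` coordinates. -/
lemma exists_hankelMatrix_mulVec_eq {N : ℕ} {g : ℕ → ℝ}
    (h : (Matrix.of fun p q => g (gapExp N p + gapExp N q)).PosDef) :
    ∃ a : Fin (N + 1) → ℝ, a (Fin.last N) = 0 ∧
      (∀ j : Fin N, (hankelMatrix g (N + 1) *ᵥ a) j.castSucc = g (N + 1 + j)) ∧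
      a ⬝ᵥ (hankelMatrix g (N + 1) *ᵥ a) ≤ g (2 * N + 2) := by
  have hA := hankelMatrix_posDef_of_gapExp h
  set A := hankelMatrix g N
  let b : Fin N → ℝ := fun j => g (N + 1 + j)
  let a₀ := A⁻¹ *ᵥ b
  have hAa : A *ᵥ a₀ = b := by
    simp only [a₀]
    rw [mulVec_mulVec, mul_nonsing_inv _ ((isUnit_iff_isUnit_det A).1 hA.isUnit), one_mulVec]
  have hAa' : ∀ j : Fin N, ∑ i : Fin N, g (j + i) * a₀ i = g (N + 1 + j) := fun j => congrFun hAa j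
  let c (t : ℝ) : Fin (N + 1) → ℝ := Fin.snoc (α := fun _ => ℝ) a₀ t
  have hc : ∀ t (j : Fin N), c t j.castSucc = a₀ j := fun t j => by simp [c]
  have hcl : ∀ t, c t (Fin.last N) = t := fun t => by simp [c]
  have ha : ∀ j : Fin N, (hankelMatrix g (N + 1) *ᵥ c 0) j.castSucc = g (N + 1 + j) := by
    intro j
    simp [mulVec, dotProduct, Fin.sum_univ_castSucc, hc, hcl, hankelMatrix, hAa']
  refine ⟨c 0, hcl 0, ha, ?_⟩
  have hne : c (-1) ≠ 0 := by
    intro h0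
    have := congrFun h0 (Fin.last N)
    simp [hcl] at this
  have hpos := h.dotProduct_mulVec_pos hne
  have hsq : c 0 ⬝ᵥ (hankelMatrix g (N + 1) *ᵥ c 0) = ∑ j : Fin N, a₀ j * g (N + 1 + j) := by
    simp [dotProduct, Fin.sum_univ_castSucc, hc, hcl, ha]
  rw [hsq]
  rw [star_trivial] at hpos
  simp only [dotProduct, mulVec, Fin.sum_univ_castSucc, hc, hcl, of_apply, gapExp_castSucc,
    gapExp_last, hAa', add_comm _ (N + 1)] at hpos
  have h1 : ∑ i : Fin N, g (N + 1 + i) * a₀ i = ∑ j : Fin N, a₀ j * g (N + 1 + j) :=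
    Finset.sum_congr rfl fun _ _ => mul_comm _ _
  have h2 : N + 1 + (N + 1) = 2 * N + 2 := by ring
  simp only [mul_neg, mul_one, add_neg_cancel, mul_zero, Finset.sum_const_zero, h1, h2] at hpos
  linarith

lemma exists_isRepMeasure_of_sum {n : ℕ} {β : ℕ → ℕ → ℝ}
    {ι : Type*} [Fintype ι] {x w : ι → ℝ} (hw : ∀ i, 0 ≤ w i)
    (h : ∀ i j, i + j ≤ 2 * n → ∑ k, w k * x k ^ (i + 3 * j) = β i j) :
    ∃ μ : Measure (ℝ × ℝ), IsRepMeasure n β μ := by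
  refine ⟨∑ k, ENNReal.ofReal (w k) • Measure.dirac (x k, x k ^ 3), fun i j hij => ?_⟩
  have hintg : ∀ k ∈ Finset.univ, Integrable (fun p : ℝ × ℝ => p.1 ^ i * p.2 ^ j)
      (ENNReal.ofReal (w k) • Measure.dirac (x k, x k ^ 3)) :=
    fun k _ => (integrable_dirac enorm_lt_top).smul_measure ENNReal.ofReal_ne_top
  refine ⟨integrable_finsetSum_measure.2 hintg, ?_⟩
  rw [integral_finsetSum_measure hintg, ← h i j hij]
  refine Finset.sum_congr rfl fun k _ => ?_
  rw [integral_smul_measure, integral_dirac, ENNReal.toReal_ofReal (hw k), smul_eq_mul, pow_add,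
    pow_mul]

lemma exists_isRepMeasure_of_hankelMatrix_posDef {n N : ℕ} (hN : 3 * n = N + 1)
    {β : ℕ → ℕ → ℝ} (hβ : ∀ i j : ℕ, i + j + 3 ≤ 2 * n → β (i + 3) j = β i (j + 1))
    (hgap : (Matrix.of fun p q => gamma3 β (gapExp N p + gapExp N q)).PosDef)
    (hH : (hankelMatrix (gamma3 β) (N + 1)).PosDef) :
    ∃ μ : Measure (ℝ × ℝ), IsRepMeasure n β μ := by
  obtain ⟨a, ha0, ha, hq⟩ := exists_hankelMatrix_mulVec_eq hgap
  obtain ⟨v, hv, hvq⟩ := hH.exists_dotProduct_mulVec_eq ha0 hq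
  let g := Function.update (gamma3 β) (2 * N + 1)
    ((hankelMatrix (gamma3 β) (N + 1) *ᵥ v) (Fin.last N))
  have hg : ∀ p, p ≠ 2 * N + 1 → g p = gamma3 β p := fun p hp => Function.update_of_ne hp _ _
  have hgH : hankelMatrix g (N + 1) = hankelMatrix (gamma3 β) (N + 1) := by
    ext i j
    exact hg _ (by omega)
  obtain ⟨x, w, hw, hle, heq⟩ := exists_atoms_of_hankelMatrix_posDef g N (by rwa [hgH]) v (by
    intro j
    rw [hgH]
    induction j using Fin.lastCases with
    | last => rw [Fin.val_last, show N + 1 + N = 2 * N + 1 by ring]; simp [g]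
    | cast j =>
      rw [hv _ j.castSucc_lt_last.ne, ha, hg _ (by simp; omega), Fin.val_castSucc])
  refine exists_isRepMeasure_of_sum hw (x := x) fun i j hij => ?_
  rw [← gamma3_add_three_mul hβ i j hij]
  rcases Nat.lt_or_ge (2 * N + 1) (i + 3 * j) with h | h
  · rw [show i + 3 * j = 2 * N + 2 by omega, heq, hgH, hvq]
  · rw [hle _ h, hg _ (by omega)]

lemma IsRepMeasure.hankelMatrix_posDef {n N : ℕ} (hn : 3 ≤ n) (hN : 3 * n = N + 1)
    {β : ℕ → ℕ → ℝ} (hβ : ∀ i j : ℕ, i + j + 3 ≤ 2 * n → β (i + 3) j = β i (j + 1))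
    (hgap : (Matrix.of fun p q => gamma3 β (gapExp N p + gapExp N q)).PosDef)
    {μ : Measure (ℝ × ℝ)} (hμ : IsRepMeasure n β μ) :
    (hankelMatrix (gamma3 β) (N + 1)).PosDef := by
  have hsymm : (hankelMatrix (gamma3 β) (N + 1)).IsHermitian := by
    rw [IsHermitian, conjTranspose_eq_transpose_of_trivial, hankelMatrix_isSymm]
  refine .of_dotProduct_mulVec_pos hsymm fun c hc => ?_
  rw [star_trivial]
  obtain ⟨hintg, hsum⟩ := dotProduct_mulVec_eq_integral_sq (μ := μ) (g := gamma3 β)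
    (e := fun i : Fin (N + 1) => (i : ℕ))
    (fun i j => hμ.integral_pow_fst hn hβ (by omega)) c
  change _ = c ⬝ᵥ (hankelMatrix (gamma3 β) (N + 1) *ᵥ c) at hsum
  rw [← hsum]
  refine lt_of_le_of_ne (integral_nonneg fun z => sq_nonneg _) fun h0 => ?_
  let P : Polynomial ℝ := ∑ i : Fin (N + 1), Polynomial.monomial i (c i)
  have hPc : ∀ i : Fin (N + 1), P.coeff i = c i := by
    intro i
    simp [P, Polynomial.coeff_monomial, Fin.val_inj]
  have hPdeg : P.natDegree ≤ N := Polynomial.natDegree_sum_le_of_forall_le _ _ fun i _ =>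
    (Polynomial.natDegree_monomial_le _).trans (Nat.lt_succ_iff.1 i.2)
  have hP0 : P ≠ 0 := by
    rintro hP
    refine hc (funext fun i => ?_)
    rw [← hPc, hP, Polynomial.coeff_zero, Pi.zero_apply]
  have hPev : ∀ x : ℝ, P.eval x = ∑ i, c i * x ^ (i : ℕ) := by
    intro x
    simp [P, Polynomial.eval_finsetSum]
  have hPae : ∀ᵐ z ∂μ, P.eval z.1 = 0 := by
    filter_upwards [(integral_eq_zero_iff_of_nonneg (fun z => sq_nonneg _) hintg).1 h0.symm] with z hz
    rw [hPev]
    exact pow_eq_zero_iff two_ne_zero |>.1 hz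
  obtain ⟨Q, hQ0, hQdeg, hQN, hQae⟩ : ∃ Q : Polynomial ℝ, Q ≠ 0 ∧ Q.natDegree ≤ N + 1 ∧
      Q.coeff N = 0 ∧ ∀ᵐ z ∂μ, Q.eval z.1 = 0 := by
    by_cases hPN : P.coeff N = 0
    · exact ⟨P, hP0, hPdeg.trans N.le_succ, hPN, hPae⟩
    · obtain ⟨M, rfl⟩ : ∃ M, N = M + 1 := ⟨N - 1, by omega⟩
      refine ⟨(Polynomial.X - Polynomial.C (P.coeff M / P.coeff (M + 1))) * P,
        mul_ne_zero (Polynomial.X_sub_C_ne_zero _) hP0, ?_, ?_, ?_⟩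
      · refine Polynomial.natDegree_mul_le.trans ?_
        rw [Polynomial.natDegree_X_sub_C]
        omega
      · rw [sub_mul, Polynomial.coeff_sub, Polynomial.coeff_X_mul, Polynomial.coeff_C_mul,
          div_mul_cancel₀ _ hPN, sub_self]
      · filter_upwards [hPae] with z hz
        rw [Polynomial.eval_mul, hz, mul_zero]
  let d : Fin (N + 1) → ℝ := fun k => Q.coeff (gapExp N k)
  have hd : d ≠ 0 := by
    intro hd
    refine hQ0 (Polynomial.funext fun x => ?_)
    rw [← Polynomial.eval_eq_sum_gapExp hQdeg hQN, Polynomial.eval_zero]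
    exact Finset.sum_eq_zero fun k _ => by
      rw [show Q.coeff (gapExp N k) = 0 from congrFun hd k, zero_mul]
  have hpos := hgap.dotProduct_mulVec_pos hd
  rw [star_trivial, ← (dotProduct_mulVec_eq_integral_sq (μ := μ) (g := gamma3 β) (e := gapExp N)
    (fun i j => hμ.integral_pow_fst hn hβ
      (by unfold gapExp; split_ifs <;> omega)) d).2] at hpos
  refine hpos.ne' (integral_eq_zero_of_ae ?_)
  filter_upwards [hQae] with z hz
  simp only [d]
  rw [Polynomial.eval_eq_sum_gapExp hQdeg hQN, hz]
  simp

/-- The `(y − x³)`-pure truncated moment problem: if `M_n(β)` is positive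
semidefinite and `(y − x³)`-pure, then `β` has a representing measure if and
only if `det (γ_{p+q})_{0 ≤ p,q ≤ 3n−1} > 0`. -/
theorem pure_y_eq_x3_det (n : ℕ) (hn : 3 ≤ n)
    (β : ℕ → ℕ → ℝ) (hpure : IsPure n 3 β) :
    (∃ μ : Measure (ℝ × ℝ), IsRepMeasure n β μ) ↔
      0 < (Matrix.of fun p q : Fin (3 * n) =>
        gamma3 β ((p : ℕ) + (q : ℕ))).det := by
  obtain ⟨-, hβ, -, hhat⟩ := hpure
  obtain ⟨N, hN⟩ : ∃ N, 3 * n = N + 1 := ⟨3 * n - 1, by omega⟩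
  have hgap := posDef_gapExp hn hN hβ hhat
  rw [hN]
  change _ ↔ 0 < (hankelMatrix (gamma3 β) (N + 1)).det
  constructor
  · rintro ⟨μ, hμ⟩
    exact (hμ.hankelMatrix_posDef hn hN hβ hgap).det_pos
  · intro hdet
    refine exists_isRepMeasure_of_hankelMatrix_posDef hN hβ hgap
      (posDef_of_submatrix_castSucc_of_det_pos ?_ (hankelMatrix_posDef_of_gapExp hgap) hdet)
    rw [IsHermitian, conjTranspose_eq_transpose_of_trivial, hankelMatrix_isSymm]
end
end

section
/- Let n ≥ 3 be an integer and let β be a bivariate sequence of degree 2n such that M_n(β) is positive semidefinite and (y−x³)-pure (take d = 3). For 0 ≤ p ≤ 6n−2 set γ_p := β_{p mod 3, ⌊p/3⌋}. Let C₁ := (γ_{p+q})_{0 ≤ p,q ≤ 3n−2} and let h ∈ ℝ^{3n−1} be the vector with coordinates h_p := γ_{p+3n−1} for 0 ≤ p ≤ 3n−2. Then C₁ is positive definite, and with φ := hᵀ C₁⁻¹ h the following hold: β admits a representing measure if and only if β_{1,2n−1} > φ; and in that case, for every x_0 ∈ ℝ there exists a finitely atomic representing measure for β whose support contains (x_0,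 x_0³), while every representing measure for β is supported in the curve {(x, x³) : x ∈ ℝ}. -/
open MeasureTheory Matrix

noncomputable section

/-- The Hankel matrix `C₁ = (γ_{p+q})_{0 ≤ p,q ≤ 3n−2}`. -/
def C1mat (n : ℕ) (β : ℕ → ℕ → ℝ) : Matrix (Fin (3 * n - 1)) (Fin (3 * n - 1)) ℝ :=
  Matrix.of fun p q => gamma3 β ((p : ℕ) + (q : ℕ))

/-- The vector `h` with `h_p = γ_{p + 3n−1}` for `0 ≤ p ≤ 3n−2`. -/
def hvec (n : ℕ) (β : ℕ → ℕ → ℝ) : Fin (3 * n - 1) → ℝ :=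
  fun p => gamma3 β ((p : ℕ) + (3 * n - 1))

/-- `φ = hᵀ C₁⁻¹ h`. -/
def phi3 (n : ℕ) (β : ℕ → ℕ → ℝ) : ℝ :=
  hvec n β ⬝ᵥ (C1mat n β)⁻¹ *ᵥ hvec n β

theorem Matrix.PosDef.fromBlocks₁₁_iff {m n : Type*} [Fintype m] [Fintype n] [DecidableEq m]
    [DecidableEq n] {A : Matrix m m ℝ} (hA : A.PosDef) (B : Matrix m n ℝ) (D : Matrix n n ℝ) :
    (fromBlocks A B Bᴴ D).PosDef ↔ (D - Bᴴ * A⁻¹ * B).PosDef := by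
  have : Invertible A := hA.isUnit.invertible
  have hdet : (fromBlocks A B Bᴴ D).det = A.det * (D - Bᴴ * A⁻¹ * B).det := by
    rw [det_fromBlocks₁₁, invOf_eq_nonsing_inv]
  constructor
  · intro h
    refine ((PosDef.fromBlocks₁₁ B D hA).1 h.posSemidef).posDef_iff_det_ne_zero.2 fun h0 => ?_
    exact h.det_pos.ne' (by rw [hdet, h0, mul_zero])
  · intro h
    refine ((PosDef.fromBlocks₁₁ B D hA).2 h.posSemidef).posDef_iff_det_ne_zero.2 ?_
    rw [hdet]
    exact (mul_pos hA.det_pos h.det_pos).ne'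

/-- A positive definite matrix and a Hermitian matrix are simultaneously diagonalized by a
congruence. -/
theorem Matrix.PosDef.exists_simultaneous_diagonalization {m : Type*} [Fintype m] [DecidableEq m]
    {A B : Matrix m m ℝ} (hA : A.PosDef) (hB : B.IsHermitian) :
    ∃ (W : Matrix m m ℝ) (d : m → ℝ), IsUnit W ∧ A = Wᵀ * W ∧ B = Wᵀ * diagonal d * W := by
  obtain ⟨C, hC, hAC⟩ : ∃ C : Matrix m m ℝ, IsUnit C ∧ A = Cᵀ * C := by
    have hC : ∃ C : Matrix m m ℝ, A = Cᵀ * C := by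
      open scoped MatrixOrder in
      exact CStarAlgebra.nonneg_iff_eq_star_mul_self.1 hA.posSemidef.nonneg
    obtain ⟨C, rfl⟩ := hC
    refine ⟨C, ?_, rfl⟩
    have := hA.det_pos.ne'
    rw [det_mul, det_transpose] at this
    rw [isUnit_iff_isUnit_det, isUnit_iff_ne_zero]
    exact left_ne_zero_of_mul this
  have hdet : IsUnit C.det := (isUnit_iff_isUnit_det C).1 hC
  have hdet' : IsUnit Cᵀ.det := by rwa [det_transpose]
  have hM : ((C⁻¹)ᵀ * B * C⁻¹).IsHermitian := by
    simpa using isHermitian_conjTranspose_mul_mul (C⁻¹) hB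
  obtain ⟨U, d, hUU, hUU', h1⟩ : ∃ (U : Matrix m m ℝ) (d : m → ℝ), U * Uᵀ = 1 ∧ Uᵀ * U = 1 ∧
      (C⁻¹)ᵀ * B * C⁻¹ = U * diagonal d * Uᵀ := by
    refine ⟨hM.eigenvectorUnitary, hM.eigenvalues,
      (Unitary.mem_iff.1 hM.eigenvectorUnitary.2).2, (Unitary.mem_iff.1 hM.eigenvectorUnitary.2).1,
      ?_⟩
    exact hM.spectral_theorem
  refine ⟨Uᵀ * C, d, ?_, ?_, ?_⟩
  · exact (IsUnit.of_mul_eq_one _ hUU').mul hC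
  · rw [transpose_mul, transpose_transpose, Matrix.mul_assoc, ← Matrix.mul_assoc U, hUU,
      Matrix.one_mul, hAC]
  · calc B = Cᵀ * ((C⁻¹)ᵀ * B * C⁻¹) * C := by
          rw [transpose_nonsing_inv, ← Matrix.mul_assoc, ← Matrix.mul_assoc,
            mul_nonsing_inv _ hdet', Matrix.one_mul, Matrix.mul_assoc, nonsing_inv_mul _ hdet,
            Matrix.mul_one]
      _ = _ := by
          rw [h1, transpose_mul, transpose_transpose]
          simp only [Matrix.mul_assoc]

/-- The matrix with entries `γ (e i + e j)`. -/
def hankel {ι : Type*} (γ : ℕ → ℝ) (e : ι → ℕ) : Matrix ι ι ℝ :=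
  Matrix.of fun i j => γ (e i + e j)

theorem hankel_isHermitian {ι : Type*} (γ : ℕ → ℝ) (e : ι → ℕ) : (hankel γ e).IsHermitian := by
  ext i j
  simp [hankel, add_comm]

/-- A positive definite Hankel matrix `(γ_{p+q})_{p,q ≤ N}` has a quadrature rule. -/
theorem hankel_exists_quadrature (γ : ℕ → ℝ) (N : ℕ)
    (h : (hankel γ (Fin.val : Fin (N + 1) → ℕ)).PosDef) :
    ∃ (x w : Fin (N + 1) → ℝ), (∀ i, 0 ≤ w i) ∧ ∀ k ≤ 2 * N, ∑ i, w i * x i ^ k = γ k := by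
  have hB : (Matrix.of fun i j : Fin (N + 1) => γ (i + j + 1)).IsHermitian := by
    ext i j
    simp [add_comm]
  obtain ⟨W, d, hW, hA, hBW⟩ := h.exists_simultaneous_diagonalization hB
  have hWt : IsUnit Wᵀ := by rwa [isUnit_transpose]
  have hstep : ∀ (i : Fin (N + 1)) (k : ℕ) (hk : k + 1 < N + 1),
      W i ⟨k + 1, hk⟩ = d i * W i ⟨k, by omega⟩ := by
    intro i k hk
    have hcol : Wᵀ *ᵥ (W.col ⟨k + 1, hk⟩) = Wᵀ *ᵥ ((diagonal d * W).col ⟨k, by omega⟩) := by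
      ext j
      have h1 := congrFun (congrFun hA j) ⟨k + 1, hk⟩
      have h2 := congrFun (congrFun hBW j) ⟨k, by omega⟩
      rw [Matrix.mul_assoc] at h2
      exact h1.symm.trans h2
    have := congrFun (mulVec_injective_of_isUnit hWt hcol) i
    simpa [Matrix.col, diagonal_mul] using this
  obtain ⟨y, hpow⟩ : ∃ y : Fin (N + 1) → ℝ,
      ∀ (i : Fin (N + 1)) (k : ℕ) (hk : k < N + 1), W i ⟨k, hk⟩ = d i ^ k * y i := by
    refine ⟨fun i => W i 0, fun i k => ?_⟩
    induction k with
    | zero => intro hk; simp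
    | succ k ih => intro hk; rw [hstep i k hk, ih, pow_succ]; ring
  refine ⟨d, fun i => y i ^ 2, fun i => sq_nonneg _, fun k hk => ?_⟩
  obtain ⟨a, b, ha, hb, rfl⟩ : ∃ a b, a < N + 1 ∧ b < N + 1 ∧ k = a + b :=
    ⟨min k N, k - min k N, by omega, by omega, by omega⟩
  have h1 := congrFun (congrFun hA ⟨a, ha⟩) ⟨b, hb⟩
  simp only [hankel, of_apply, mul_apply, transpose_apply, hpow] at h1
  rw [h1]
  exact Finset.sum_congr rfl fun i _ => by ring

/-- The exponents `0, …, m - 1` followed by the exponents `m + c j`. -/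
def extExp (m : ℕ) {κ : Type*} (c : κ → ℕ) : Fin m ⊕ κ → ℕ :=
  Sum.elim Fin.val fun j => m + c j

theorem hankel_extExp (γ : ℕ → ℝ) (m : ℕ) {κ : Type*} (c : κ → ℕ) :
    hankel γ (extExp m c) = fromBlocks (hankel γ (Fin.val : Fin m → ℕ))
      (Matrix.of fun i j => γ (i + (m + c j))) (Matrix.of fun i j => γ (i + (m + c j)))ᴴ
      (Matrix.of fun i j => γ (m + c i + (m + c j))) := by
  ext (i | i) (j | j)
  · rfl
  · rfl
  · exact congrArg γ (add_comm _ _)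
  · rfl

theorem hankel_extExp_posDef_iff {γ : ℕ → ℝ} {m : ℕ}
    (h : (hankel γ (Fin.val : Fin m → ℕ)).PosDef) {κ : Type*} [Fintype κ] [DecidableEq κ]
    (c : κ → ℕ) :
    (hankel γ (extExp m c)).PosDef ↔ (Matrix.of fun i j : κ => γ (m + c i + (m + c j)) -
      (fun p : Fin m => γ (p + (m + c i))) ⬝ᵥ (hankel γ (Fin.val : Fin m → ℕ))⁻¹ *ᵥ
        fun p => γ (p + (m + c j))).PosDef := by
  rw [hankel_extExp, h.fromBlocks₁₁_iff]
  convert! Iff.rfl using 2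
  ext i j
  simp only [Matrix.sub_apply, of_apply]
  rw [Matrix.mul_assoc]
  rfl

theorem posDef_unit_iff (a : Unit → Unit → ℝ) : (Matrix.of a).PosDef ↔ 0 < a () () := by
  have : Matrix.of a = diagonal fun _ => a () () := by ext ⟨⟩ ⟨⟩; simp
  rw [this, posDef_diagonal_iff]
  simp

/-- The missing entry of a Hankel matrix can be chosen so as to preserve positive
definiteness. -/
theorem exists_hankel_completion {γ : ℕ → ℝ} {m : ℕ}
    (h : (hankel γ (Fin.val : Fin m → ℕ)).PosDef)
    (h0 : (hankel γ (extExp m fun _ : Unit => 0)).PosDef)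
    (h1 : (hankel γ (extExp m fun _ : Unit => 1)).PosDef) :
    ∃ s, (hankel (Function.update γ (2 * m + 1) s) (Fin.val : Fin (m + 2) → ℕ)).PosDef := by
  rw [hankel_extExp_posDef_iff h, posDef_unit_iff] at h0 h1
  set s := (fun p : Fin m => γ (p + (m + 0))) ⬝ᵥ (hankel γ (Fin.val : Fin m → ℕ))⁻¹ *ᵥ
    (fun p => γ (p + (m + 1))) with hs
  refine ⟨s, ?_⟩
  set γ' := Function.update γ (2 * m + 1) s with hγ'
  have hne : ∀ k, k ≠ 2 * m + 1 → γ' k = γ k := fun k hk => by simp [hγ', hk]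
  have hH : hankel γ' (Fin.val : Fin m → ℕ) = hankel γ Fin.val := by
    ext i j
    exact hne _ (by omega)
  have key : (hankel γ' (extExp m (Fin.val : Fin 2 → ℕ))).PosDef := by
    rw [hankel_extExp_posDef_iff (hH ▸ h), hH]
    have hv : ∀ j : Fin 2, (fun p : Fin m => γ' (p + (m + j))) =
        fun p : Fin m => γ (p + (m + j)) :=
      fun j => funext fun p => hne _ (by omega)
    simp only [hv]
    have hsymm : ∀ u v : Fin m → ℝ, u ⬝ᵥ (hankel γ (Fin.val : Fin m → ℕ))⁻¹ *ᵥ v =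
        v ⬝ᵥ (hankel γ (Fin.val : Fin m → ℕ))⁻¹ *ᵥ u := by
      intro u v
      have ht : ((hankel γ (Fin.val : Fin m → ℕ))⁻¹)ᵀ = (hankel γ (Fin.val : Fin m → ℕ))⁻¹ :=
        (hankel_isHermitian γ _).inv
      rw [dotProduct_mulVec, dotProduct_comm, ← mulVec_transpose, ht]
    have hd : (Matrix.of fun i j : Fin 2 => γ' (m + i + (m + j)) -
        (fun p : Fin m => γ (p + (m + i))) ⬝ᵥ (hankel γ (Fin.val : Fin m → ℕ))⁻¹ *ᵥ
          fun p => γ (p + (m + j))) = diagonal fun i : Fin 2 => γ (m + i + (m + i)) -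
        (fun p : Fin m => γ (p + (m + i))) ⬝ᵥ (hankel γ (Fin.val : Fin m → ℕ))⁻¹ *ᵥ
          fun p => γ (p + (m + i)) := by
      have hγs : γ' (2 * m + 1) = s := by simp [hγ']
      ext i j
      fin_cases i <;> fin_cases j
      · simp only [of_apply, diagonal_apply_eq]
        rw [hne _ (by simp; omega)]
      · simp only [of_apply]
        rw [diagonal_apply_ne _ (by simp), sub_eq_zero]
        refine Eq.trans ?_ hs
        rw [← hγs]
        congr 1
        simp
        omega
      · simp only [of_apply]
        rw [diagonal_apply_ne _ (by simp), sub_eq_zero, hsymm]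
        refine Eq.trans ?_ hs
        rw [← hγs]
        congr 1
        simp
        omega
      · simp only [of_apply, diagonal_apply_eq]
        rw [hne _ (by simp; omega)]
    rw [hd, posDef_diagonal_iff]
    intro i
    fin_cases i
    · exact h0
    · exact h1
  have he : hankel γ' (Fin.val : Fin (m + 2) → ℕ) = (hankel γ' (extExp m
      (Fin.val : Fin 2 → ℕ))).submatrix finSumFinEquiv.symm finSumFinEquiv.symm := by
    ext i j
    obtain ⟨i, rfl⟩ := finSumFinEquiv.surjective i
    obtain ⟨j, rfl⟩ := finSumFinEquiv.surjective j
    rcases i with i | i <;> rcases j with j | j <;> simp [hankel, extExp]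
  rw [he]
  exact key.submatrix finSumFinEquiv.symm.injective

theorem Matrix.PosDef.exists_pos_sub_smul {m : Type*} [Fintype m] [DecidableEq m]
    {A B : Matrix m m ℝ} (hA : A.PosDef) (hB : B.IsHermitian) :
    ∃ ε : ℝ, 0 < ε ∧ (A - ε • B).PosDef := by
  obtain ⟨W, d, hW, rfl, rfl⟩ := hA.exists_simultaneous_diagonalization hB
  have hS : 0 ≤ ∑ i, |d i| := Finset.sum_nonneg fun i _ => abs_nonneg _
  refine ⟨(1 + ∑ i, |d i|)⁻¹, by positivity, ?_⟩
  set ε := (1 + ∑ i, |d i|)⁻¹ with hε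
  have h : Wᵀ * W - ε • (Wᵀ * diagonal d * W) = star W * diagonal (fun i => 1 - ε * d i) * W := by
    have : diagonal (fun i => 1 - ε * d i) = 1 - ε • diagonal d := by
      ext i j
      by_cases hij : i = j <;> simp [hij]
    rw [this, star_eq_conjTranspose, conjTranspose_eq_transpose_of_trivial]
    simp [Matrix.mul_sub, Matrix.sub_mul]
  rw [h, hW.posDef_star_left_conjugate_iff, posDef_diagonal_iff]
  intro i
  have h1 : d i ≤ ∑ j, |d j| :=
    (le_abs_self _).trans (Finset.single_le_sum (fun j _ => abs_nonneg (d j)) (Finset.mem_univ i))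
  rw [sub_pos, hε, inv_mul_lt_iff₀ (by positivity)]
  linarith

/-- A quadrature rule for a positive definite Hankel matrix can be chosen with a prescribed
node. -/
theorem hankel_exists_quadrature_with_node {γ : ℕ → ℝ} {N : ℕ}
    (h : (hankel γ (Fin.val : Fin (N + 1) → ℕ)).PosDef) (x₀ : ℝ) :
    ∃ (x w : Option (Fin (N + 1)) → ℝ), (∀ i, 0 ≤ w i) ∧ x none = x₀ ∧ 0 < w none ∧
      ∀ k ≤ 2 * N, ∑ i, w i * x i ^ k = γ k := by
  obtain ⟨ε, hε, hpd⟩ := h.exists_pos_sub_smul (hankel_isHermitian (fun k => x₀ ^ k) Fin.val)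
  obtain ⟨x, w, hw, hxw⟩ := hankel_exists_quadrature (fun k => γ k - ε * x₀ ^ k) N hpd
  refine ⟨fun i => i.elim x₀ x, fun i => i.elim ε w, ?_, rfl, hε, fun k hk => ?_⟩
  · rintro (_ | i)
    · exact hε.le
    · exact hw i
  · simp [Fintype.sum_option, hxw k hk]

/-- A nonnegatively weighted finite family of points can be collapsed to a positively weighted
finite set. -/
theorem exists_finset_weights {ι α : Type*} [Fintype ι] (f : ι → α) (w : ι → ℝ)
    (hw : ∀ i, 0 ≤ w i) :
    ∃ (t : Finset α) (c : α → ℝ), (∀ p ∈ t, 0 < c p) ∧ (∀ i, 0 < w i → f i ∈ t) ∧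
      ∀ g : α → ℝ, ∑ p ∈ t, c p * g p = ∑ i, w i * g (f i) := by
  classical
  set s : Finset ι := {i | 0 < w i} with hs
  refine ⟨s.image f, fun p => ∑ i ∈ s with f i = p, w i, ?_, ?_, fun g => ?_⟩
  · intro p hp
    obtain ⟨i, hi, rfl⟩ := Finset.mem_image.1 hp
    exact Finset.sum_pos (fun j hj => (Finset.mem_filter.1 (Finset.mem_filter.1 hj).1).2)
      ⟨i, Finset.mem_filter.2 ⟨hi, rfl⟩⟩
  · exact fun i hi => Finset.mem_image_of_mem f (by simpa [hs] using hi)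
  · have h1 : ∑ i, w i * g (f i) = ∑ i ∈ s, w i * g (f i) := by
      refine (Finset.sum_subset (Finset.subset_univ s) fun i _ hi => ?_).symm
      have : w i = 0 := le_antisymm (by simpa [hs] using hi) (hw i)
      simp [this]
    rw [h1, ← Finset.sum_fiberwise_of_maps_to (t := s.image f)
      fun i hi => Finset.mem_image_of_mem f hi]
    refine Finset.sum_congr rfl fun p _ => ?_
    rw [Finset.sum_mul]
    refine Finset.sum_congr rfl fun i hi => ?_
    rw [(Finset.mem_filter.1 hi).2]

theorem integrable_sum_dirac {α : Type*} [MeasurableSpace α] [MeasurableSingletonClass α]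
    (t : Finset α) (c : α → ℝ) (g : α → ℝ) :
    Integrable g (∑ p ∈ t, ENNReal.ofReal (c p) • Measure.dirac p) :=
  integrable_finsetSum_measure.2 fun _ _ =>
    (integrable_dirac (by simp)).smul_measure ENNReal.ofReal_ne_top

theorem integral_sum_dirac {α : Type*} [MeasurableSpace α] [MeasurableSingletonClass α]
    (t : Finset α) (c : α → ℝ) (hc : ∀ p ∈ t, 0 < c p) (g : α → ℝ) :
    ∫ p, g p ∂(∑ p ∈ t, ENNReal.ofReal (c p) • Measure.dirac p) = ∑ p ∈ t, c p * g p := by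
  rw [integral_finsetSum_measure fun p _ =>
    (integrable_dirac (by simp)).smul_measure ENNReal.ofReal_ne_top]
  refine Finset.sum_congr rfl fun p hp => ?_
  rw [integral_smul_measure, integral_dirac, ENNReal.toReal_ofReal (hc p hp).le, smul_eq_mul]

theorem integrable_sq_sum {α ι : Type*} [MeasurableSpace α] {μ : Measure α} [Fintype ι]
    {f : ι → α → ℝ} (hf : ∀ i j, Integrable (fun x => f i x * f j x) μ) (u : ι → ℝ) :
    Integrable (fun x => (∑ i, u i * f i x) ^ 2) μ := by
  have : (fun x => (∑ i, u i * f i x) ^ 2) =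
      fun x => ∑ i, ∑ j, u i * u j * (f i x * f j x) := by
    ext x
    rw [sq, Finset.sum_mul_sum]
    exact Finset.sum_congr rfl fun i _ => Finset.sum_congr rfl fun j _ => by ring
  rw [this]
  exact integrable_finsetSum _ fun i _ => integrable_finsetSum _ fun j _ => (hf i j).const_mul _

theorem integral_sq_sum {α ι : Type*} [MeasurableSpace α] {μ : Measure α} [Fintype ι]
    {f : ι → α → ℝ} (hf : ∀ i j, Integrable (fun x => f i x * f j x) μ) (u : ι → ℝ) :
    ∫ x, (∑ i, u i * f i x) ^ 2 ∂μ =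
      u ⬝ᵥ (Matrix.of fun i j => ∫ x, f i x * f j x ∂μ) *ᵥ u := by
  have : (fun x => (∑ i, u i * f i x) ^ 2) =
      fun x => ∑ i, ∑ j, u i * u j * (f i x * f j x) := by
    ext x
    rw [sq, Finset.sum_mul_sum]
    exact Finset.sum_congr rfl fun i _ => Finset.sum_congr rfl fun j _ => by ring
  rw [this, integral_finsetSum _ fun i _ => integrable_finsetSum _ fun j _ => (hf i j).const_mul _]
  simp only [dotProduct, mulVec, Finset.mul_sum, of_apply]
  refine Finset.sum_congr rfl fun i _ => ?_
  rw [integral_finsetSum _ fun j _ => (hf i j).const_mul _]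
  refine Finset.sum_congr rfl fun j _ => ?_
  rw [integral_const_mul]
  ring

theorem extExp_unit_injective (m a : ℕ) : Function.Injective (extExp m fun _ : Unit => a) := by
  rintro (i | i) (j | j) h
  · exact congrArg _ (Fin.ext h)
  · have := i.isLt
    simp only [extExp, Sum.elim_inl, Sum.elim_inr] at h
    omega
  · have := j.isLt
    simp only [extExp, Sum.elim_inl, Sum.elim_inr] at h
    omega
  · rfl

theorem eval_eq_sum_extExp {m : ℕ} {R : Polynomial ℝ} (hdeg : R.natDegree < m + 2)
    (hcoeff : R.coeff m = 0) (x : ℝ) :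
    R.eval x = ∑ i, R.coeff (extExp m (fun _ : Unit => 1) i) *
      x ^ extExp m (fun _ : Unit => 1) i := by
  rw [Polynomial.eval_eq_sum_range' hdeg, Finset.sum_range_succ, Finset.sum_range_succ, hcoeff,
    Fintype.sum_sum_type, ← Fin.sum_univ_eq_sum_range (fun i => R.coeff i * x ^ i)]
  simp [extExp]

/-- If `γ` is the moment sequence of `X` under a measure in the relevant degrees and the Hankel
form is positive definite on polynomials of degree at most `m + 1` without a term of degree `m`,
then it is positive definite on polynomials of degree at most `m`. -/
theorem hankel_posDef_of_measure {α : Type*} [MeasurableSpace α] {μ : Measure α} {X : α → ℝ}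
    {γ : ℕ → ℝ} {m : ℕ} (hm : 0 < m)
    (hint : ∀ k, k ≤ 2 * m ∨ k = 2 * m + 2 → Integrable (fun a => X a ^ k) μ ∧
      ∫ a, X a ^ k ∂μ = γ k)
    (h1 : (hankel γ (extExp m fun _ : Unit => 1)).PosDef) :
    (hankel γ (extExp m fun _ : Unit => 0)).PosDef := by
  have key : ∀ c : ℕ, c ≤ 1 → ∀ u : Fin m ⊕ Unit → ℝ,
      Integrable (fun a => (∑ i, u i * X a ^ extExp m (fun _ : Unit => c) i) ^ 2) μ ∧
      ∫ a, (∑ i, u i * X a ^ extExp m (fun _ : Unit => c) i) ^ 2 ∂μ =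
        u ⬝ᵥ hankel γ (extExp m fun _ : Unit => c) *ᵥ u := by
    intro c hc u
    have hdeg : ∀ i j, extExp m (fun _ : Unit => c) i + extExp m (fun _ : Unit => c) j ≤ 2 * m ∨
        extExp m (fun _ : Unit => c) i + extExp m (fun _ : Unit => c) j = 2 * m + 2 := by
      rintro (i | i) (j | j) <;> simp only [extExp, Sum.elim_inl, Sum.elim_inr] <;> omega
    have hf : ∀ i j, Integrable (fun a => X a ^ extExp m (fun _ : Unit => c) i *
        X a ^ extExp m (fun _ : Unit => c) j) μ := fun i j => by
      simpa only [pow_add] using (hint _ (hdeg i j)).1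
    refine ⟨integrable_sq_sum hf u, (integral_sq_sum hf u).trans ?_⟩
    congr 2
    ext i j
    simp only [hankel, of_apply, ← (hint _ (hdeg i j)).2, pow_add]
  refine PosDef.of_dotProduct_mulVec_pos (hankel_isHermitian _ _) fun u hu => ?_
  obtain ⟨hi, he⟩ := key 0 zero_le_one u
  rw [star_trivial, ← he]
  refine lt_of_le_of_ne (integral_nonneg fun a => sq_nonneg _) fun h0 => ?_
  have hae := (integral_eq_zero_iff_of_nonneg (fun a => sq_nonneg _) hi).1 h0.symm
  set Q : Polynomial ℝ := ∑ i, Polynomial.C (u i) *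
    Polynomial.X ^ extExp m (fun _ : Unit => 0) i with hQ
  have hQcoeff : ∀ i, Q.coeff (extExp m (fun _ : Unit => 0) i) = u i := by
    intro i
    simp [hQ, Polynomial.finsetSum_coeff, Polynomial.coeff_X_pow,
      (extExp_unit_injective m 0).eq_iff, -Fintype.sum_sum_type]
  have hQ0 : Q ≠ 0 := by
    rintro h
    exact hu (funext fun i => by rw [← hQcoeff i, h]; simp)
  have hQdeg : Q.natDegree ≤ m := by
    refine Polynomial.natDegree_sum_le_of_forall_le _ _ fun i _ => ?_
    refine (Polynomial.natDegree_C_mul_X_pow_le _ _).trans ?_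
    rcases i with i | i
    · exact i.isLt.le
    · simp [extExp]
  obtain ⟨S, hS0, hSdeg, hS⟩ : ∃ S : Polynomial ℝ, S ≠ 0 ∧ S.natDegree ≤ 1 ∧
      (S * Q).coeff m = 0 := by
    by_cases hc : Q.coeff m = 0
    · exact ⟨1, one_ne_zero, by simp, by simpa using hc⟩
    · refine ⟨Polynomial.C (Q.coeff m) * Polynomial.X + Polynomial.C (-Q.coeff (m - 1)), ?_,
        Polynomial.natDegree_linear_le, ?_⟩
      · intro h
        have := congrArg (fun p => Polynomial.coeff p 1) h
        simp [hc] at this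
      · obtain ⟨k, rfl⟩ : ∃ k, m = k + 1 := ⟨m - 1, by omega⟩
        rw [add_mul, mul_assoc, Polynomial.coeff_add, Polynomial.coeff_C_mul,
          Polynomial.coeff_X_mul, Polynomial.coeff_C_mul]
        simp
        ring
  have hRdeg : (S * Q).natDegree < m + 2 := by
    have := Polynomial.natDegree_mul_le (p := S) (q := Q)
    omega
  have hR0 : S * Q ≠ 0 := mul_ne_zero hS0 hQ0
  set v : Fin m ⊕ Unit → ℝ := fun i => (S * Q).coeff (extExp m (fun _ : Unit => 1) i) with hv
  have hv0 : v ≠ 0 := by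
    intro h
    refine hR0 (Polynomial.ext fun k => ?_)
    rw [Polynomial.coeff_zero]
    rcases lt_trichotomy k m with hk | rfl | hk
    · exact congrFun h (Sum.inl ⟨k, hk⟩)
    · exact hS
    · rcases (Nat.succ_le_of_lt hk).eq_or_lt with rfl | hk
      · exact congrFun h (Sum.inr ())
      · exact Polynomial.coeff_eq_zero_of_natDegree_lt (by omega)
  have hpos := h1.dotProduct_mulVec_pos hv0
  rw [star_trivial, ← (key 1 le_rfl v).2] at hpos
  refine hpos.ne' (integral_eq_zero_of_ae ?_)
  filter_upwards [hae] with a ha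
  have ha' : Q.eval (X a) = 0 := by
    rw [hQ, Polynomial.eval_finsetSum]
    simpa using ha
  rw [hv, ← eval_eq_sum_extExp hRdeg hS, Polynomial.eval_mul, ha']
  simp

theorem IsPure.eq_gamma3 {n : ℕ} {β : ℕ → ℕ → ℝ} (h : IsPure n 3 β) (i j : ℕ)
    (hij : i + j ≤ 2 * n) : β i j = gamma3 β (i + 3 * j) := by
  induction i using Nat.strong_induction_on generalizing j with
  | _ i ih =>
    rcases Nat.lt_or_ge i 3 with hi | hi
    · rw [gamma3, show (i + 3 * j) % 3 = i by omega, show (i + 3 * j) / 3 = j by omega]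
    · obtain ⟨k, rfl⟩ : ∃ k, i = k + 3 := ⟨i - 3, by omega⟩
      rw [h.2.1 k j (by omega), ih k (by omega) (j + 1) (by omega)]
      congr 1
      ring

theorem IsPure.hankel_posDef_gap {n : ℕ} {β : ℕ → ℕ → ℝ} (h : IsPure n 3 β) (hn : 3 ≤ n) :
    (hankel (gamma3 β) (extExp (3 * n - 1) fun _ : Unit => 1)).PosDef := by
  set e := extExp (3 * n - 1) fun _ : Unit => 1 with he
  have hbound : ∀ i, e i % 3 + e i / 3 ≤ n := by
    rintro (i | i) <;> simp only [he, extExp, Sum.elim_inl, Sum.elim_inr] <;> omega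
  let f : Fin (3 * n - 1) ⊕ Unit → MomIdxHat n 3 := fun i =>
    ⟨(⟨e i % 3, by have := hbound i; omega⟩, ⟨e i / 3, by have := hbound i; omega⟩),
      hbound i, Nat.mod_lt _ (by norm_num)⟩
  have hf : Function.Injective f := by
    intro i j hij
    apply extExp_unit_injective (3 * n - 1) 1
    have h1 : e i % 3 = e j % 3 := congrArg (fun p : MomIdxHat n 3 => (p.1.1 : ℕ)) hij
    have h2 : e i / 3 = e j / 3 := congrArg (fun p : MomIdxHat n 3 => (p.1.2 : ℕ)) hij
    change e i = e j
    omega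
  have hsub : hankel (gamma3 β) e = (momentMatrixHat n 3 β).submatrix f f := by
    ext i j
    have hi := hbound i
    have hj := hbound j
    change _ = β (e i % 3 + e j % 3) (e i / 3 + e j / 3)
    rw [h.eq_gamma3 _ _ (by omega)]
    change gamma3 β (e i + e j) = _
    congr 1
    omega
  rw [hsub]
  exact h.2.2.2.submatrix hf

theorem IsPure.C1mat_posDef {n : ℕ} {β : ℕ → ℕ → ℝ} (h : IsPure n 3 β) (hn : 3 ≤ n) :
    (C1mat n β).PosDef :=
  (h.hankel_posDef_gap hn).submatrix Sum.inl_injective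

theorem IsPure.phi3_lt_iff {n : ℕ} {β : ℕ → ℕ → ℝ} (h : IsPure n 3 β) (hn : 3 ≤ n) :
    phi3 n β < β 1 (2 * n - 1) ↔
      (hankel (gamma3 β) (extExp (3 * n - 1) fun _ : Unit => 0)).PosDef := by
  rw [hankel_extExp_posDef_iff (h.C1mat_posDef hn), posDef_unit_iff, sub_pos,
    h.eq_gamma3 1 (2 * n - 1) (by omega)]
  have : 3 * n - 1 + 0 + (3 * n - 1 + 0) = 1 + 3 * (2 * n - 1) := by omega
  rw [this]
  rfl

theorem IsRepMeasure.ae_mem_curve {n : ℕ} {β : ℕ → ℕ → ℝ} (h : IsPure n 3 β) (hn : 3 ≤ n)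
    {μ : Measure (ℝ × ℝ)} (hμ : IsRepMeasure n β μ) : ∀ᵐ p ∂μ, p.2 = p.1 ^ 3 := by
  obtain ⟨i1, e1⟩ := hμ 0 2 (by omega)
  obtain ⟨i2, e2⟩ := hμ 3 1 (by omega)
  obtain ⟨i3, e3⟩ := hμ 6 0 (by omega)
  have heq : (fun p : ℝ × ℝ => (p.2 - p.1 ^ 3) ^ 2) = fun p =>
      p.1 ^ 0 * p.2 ^ 2 - 2 * (p.1 ^ 3 * p.2 ^ 1) + p.1 ^ 6 * p.2 ^ 0 := by
    ext p
    ring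
  have hi : Integrable (fun p : ℝ × ℝ => (p.2 - p.1 ^ 3) ^ 2) μ := by
    rw [heq]
    exact (i1.sub (i2.const_mul 2)).add i3
  have h0 : ∫ p : ℝ × ℝ, (p.2 - p.1 ^ 3) ^ 2 ∂μ = 0 := by
    have h12 : ∫ p : ℝ × ℝ, p.1 ^ 0 * p.2 ^ 2 - 2 * (p.1 ^ 3 * p.2 ^ 1) ∂μ =
        β 0 2 - 2 * β 3 1 := by
      rw [integral_sub i1 (i2.const_mul 2), integral_const_mul, e1, e2]
    rw [heq]
    refine (integral_add (i1.sub (i2.const_mul 2)) i3).trans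
      ((congrArg₂ (· + ·) h12 e3).trans ?_)
    rw [h.eq_gamma3 0 2 (by omega), h.eq_gamma3 3 1 (by omega), h.eq_gamma3 6 0 (by omega)]
    norm_num
    ring
  filter_upwards [(integral_eq_zero_iff_of_nonneg (fun p => sq_nonneg _) hi).1 h0] with p hp
  exact sub_eq_zero.1 (pow_eq_zero_iff two_ne_zero |>.1 hp)

theorem IsRepMeasure.integral_fst_pow {n : ℕ} {β : ℕ → ℕ → ℝ} (h : IsPure n 3 β) (hn : 3 ≤ n)
    {μ : Measure (ℝ × ℝ)} (hμ : IsRepMeasure n β μ) {k : ℕ} (hk : k % 3 + k / 3 ≤ 2 * n) :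
    Integrable (fun p : ℝ × ℝ => p.1 ^ k) μ ∧ ∫ p : ℝ × ℝ, p.1 ^ k ∂μ = gamma3 β k := by
  have hae : (fun p : ℝ × ℝ => p.1 ^ (k % 3) * p.2 ^ (k / 3)) =ᵐ[μ] fun p => p.1 ^ k := by
    filter_upwards [hμ.ae_mem_curve h hn] with p hp
    rw [hp, ← pow_mul, ← pow_add, Nat.mod_add_div]
  obtain ⟨hi, he⟩ := hμ _ _ hk
  exact ⟨hi.congr hae, (integral_congr_ae hae).symm.trans he⟩

theorem IsPure.exists_atomic_measure {n : ℕ} {β : ℕ → ℕ → ℝ} (h : IsPure n 3 β) (hn : 3 ≤ n)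
    (hφ : phi3 n β < β 1 (2 * n - 1)) (x₀ : ℝ) :
    ∃ (t : Finset (ℝ × ℝ)) (c : ℝ × ℝ → ℝ), (∀ p ∈ t, 0 < c p) ∧ (x₀, x₀ ^ 3) ∈ t ∧
      IsRepMeasure n β (∑ p ∈ t, ENNReal.ofReal (c p) • Measure.dirac p) := by
  obtain ⟨s, hs⟩ := exists_hankel_completion (h.C1mat_posDef hn) ((h.phi3_lt_iff hn).1 hφ)
    (h.hankel_posDef_gap hn)
  obtain ⟨x, w, hw, hx₀, hw₀, hq⟩ := hankel_exists_quadrature_with_node hs x₀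
  obtain ⟨t, c, hc, ht, hsum⟩ := exists_finset_weights (fun i => (x i, x i ^ 3)) w hw
  refine ⟨t, c, hc, by simpa [hx₀] using ht none hw₀, fun i j hij =>
    ⟨integrable_sum_dirac t c _, ?_⟩⟩
  rw [integral_sum_dirac t c hc, hsum, h.eq_gamma3 i j hij]
  have := hq (i + 3 * j) (by omega)
  rw [Function.update_of_ne (by omega)] at this
  simpa only [pow_add, pow_mul] using this

/-- The `(y − x³)`-pure truncated moment problem: `C₁` is positive definite, `β`
has a representing measure iff `β_{1,2n−1} > φ`, and in that case every point
`(x₀, x₀³)` of the curve `y = x³` lies in the (finite) support of some finitely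
atomic representing measure, while every representing measure is supported in
the curve `y = x³`. -/
theorem pure_y_eq_x3 (n : ℕ) (hn : 3 ≤ n)
    (β : ℕ → ℕ → ℝ) (hpure : IsPure n 3 β) :
    (C1mat n β).PosDef ∧
    ((∃ μ : Measure (ℝ × ℝ), IsRepMeasure n β μ) ↔ phi3 n β < β 1 (2 * n - 1)) ∧
    (phi3 n β < β 1 (2 * n - 1) →
      (∀ x₀ : ℝ, ∃ (t : Finset (ℝ × ℝ)) (c : ℝ × ℝ → ℝ),
        (∀ p ∈ t, 0 < c p) ∧ (x₀, x₀ ^ 3) ∈ t ∧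
        IsRepMeasure n β (∑ p ∈ t, ENNReal.ofReal (c p) • Measure.dirac p)) ∧
      (∀ μ : Measure (ℝ × ℝ), IsRepMeasure n β μ →
        μ {p : ℝ × ℝ | p.2 ≠ p.1 ^ 3} = 0)) := by
  refine ⟨hpure.C1mat_posDef hn, ⟨?_, fun hφ => ?_⟩, fun hφ =>
    ⟨hpure.exists_atomic_measure hn hφ, fun μ hμ => ae_iff.1 (hμ.ae_mem_curve hpure hn)⟩⟩
  · rintro ⟨μ, hμ⟩
    exact (hpure.phi3_lt_iff hn).2 (hankel_posDef_of_measure (by omega)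
      (fun k hk => hμ.integral_fst_pow hpure hn (by omega)) (hpure.hankel_posDef_gap hn))
  · obtain ⟨t, c, -, -, hμ⟩ := hpure.exists_atomic_measure hn hφ 0
    exact ⟨_, hμ⟩
end
end

section
/- Let d ≥ 4 and n ≥ d be integers and let β be a bivariate sequence of degree 2n such that M_n(β) is positive semidefinite and (y−x^d)-pure. For integers p ≥ 0 with (p mod d) + ⌊p/d⌋ ≤ 2n set γ_p := β_{p mod d, ⌊p/d⌋}. Let S := {m ∈ ℤ : 0 ≤ m ≤ nd and (m mod d) + ⌊m/d⌋ ≤ n}, S′ := S ∖ {nd}, and m₀ := nd − d² + 3d − 1. Let C₁ := (γ_{p+q})_{p,q ∈ S′} and let h be the vector indexed by S′ with coordinates h_p := γ_{p+m₀} (all indices p+q for p,q ∈ S′ and p+m₀ for p ∈ S′ correspond to genuine moments of β). Then C₁ is positive definite, and setting φ := hᵀ C₁⁻¹ h and λ := γ_{2m₀} = β_{d−2, 2n−2d+5}, the following holds: if λ = φ, then the support of every representing measure for β contains at most nd − d + 1 points. -/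
open MeasureTheory Matrix

noncomputable section

/-- The univariate sequence `γ_p = β_{p mod d, ⌊p/d⌋}`. -/
def gammad (d : ℕ) (β : ℕ → ℕ → ℝ) (p : ℕ) : ℝ := β (p % d) (p / d)

/-- Index set `S′ = S ∖ {nd}`, where `S = {m : 0 ≤ m ≤ nd, (m mod d) + ⌊m/d⌋ ≤ n}`. -/
abbrev SIdx' (n d : ℕ) : Type :=
  {m : Fin (n * d + 1) // ((m : ℕ) % d + (m : ℕ) / d ≤ n) ∧ (m : ℕ) ≠ n * d}

/-- `m₀ = nd − d² + 3d − 1`. -/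
def m0 (n d : ℕ) : ℕ := n * d - d ^ 2 + 3 * d - 1

/-- The matrix `C₁ = (γ_{p+q})_{p,q ∈ S′}`. -/
def C1big (n d : ℕ) (β : ℕ → ℕ → ℝ) : Matrix (SIdx' n d) (SIdx' n d) ℝ :=
  Matrix.of fun p q => gammad d β ((p.1 : ℕ) + (q.1 : ℕ))

/-- The vector `h = (γ_{p+m₀})_{p ∈ S′}`. -/
def hbig (n d : ℕ) (β : ℕ → ℕ → ℝ) : SIdx' n d → ℝ :=
  fun p => gammad d β ((p.1 : ℕ) + m0 n d)

/-- `φ = hᵀ C₁⁻¹ h`. -/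
def phiBig (n d : ℕ) (β : ℕ → ℕ → ℝ) : ℝ :=
  hbig n d β ⬝ᵥ (C1big n d β)⁻¹ *ᵥ hbig n d β

/-- `λ = γ_{2m₀} = β_{d−2, 2n−2d+5}`. -/
def lamBig (n d : ℕ) (β : ℕ → ℕ → ℝ) : ℝ := gammad d β (2 * m0 n d)

/-- Under the column relations, `γ` at `p + q` is the moment of the product of the monomials
attached to `p` and `q`. -/
theorem gammad_add {n d : ℕ} {β : ℕ → ℕ → ℝ} (hd : 0 < d)
    (hrel : ∀ i j : ℕ, i + j + d ≤ 2 * n → β (i + d) j = β i (j + 1)) (p q : ℕ)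
    (hp : p % d + p / d ≤ n) (hq : q % d + q / d ≤ n) :
    gammad d β (p + q) = β (p % d + q % d) (p / d + q / d) := by
  have hpd := Nat.mod_lt p hd
  have hqd := Nat.mod_lt q hd
  rw [gammad, Nat.add_mod, Nat.add_div hd]
  split_ifs with h
  · rw [Nat.mod_eq_sub_mod h, Nat.mod_eq_of_lt (by omega), ← hrel _ _ (by omega),
      Nat.sub_add_cancel h]
  · rw [Nat.mod_eq_of_lt (by omega), Nat.add_zero]

/-- The matrix `C₁` is positive definite, being a principal submatrix of `M̂_n(β)`. -/
theorem C1big_posDef {n d : ℕ} {β : ℕ → ℕ → ℝ} (hd : 0 < d)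
    (hrel : ∀ i j : ℕ, i + j + d ≤ 2 * n → β (i + d) j = β i (j + 1))
    (hhat : (momentMatrixHat n d β).PosDef) : (C1big n d β).PosDef := by
  let f : SIdx' n d → MomIdxHat n d := fun p =>
    ⟨(⟨(p.1 : ℕ) % d, Nat.lt_succ_of_le ((Nat.le_add_right _ _).trans p.2.1)⟩,
      ⟨(p.1 : ℕ) / d, Nat.lt_succ_of_le ((Nat.le_add_left _ _).trans p.2.1)⟩),
      p.2.1, Nat.mod_lt _ hd⟩
  have hf : Function.Injective f := by
    intro p q h
    have h₁ : (p.1 : ℕ) % d = (q.1 : ℕ) % d := congrArg (fun z => (z.1.1 : ℕ)) h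
    have h₂ : (p.1 : ℕ) / d = (q.1 : ℕ) / d := congrArg (fun z => (z.1.2 : ℕ)) h
    apply Subtype.ext
    apply Fin.ext
    rw [← Nat.mod_add_div (p.1 : ℕ) d, ← Nat.mod_add_div (q.1 : ℕ) d, h₁, h₂]
  have h : C1big n d β = (momentMatrixHat n d β).submatrix f f := by
    ext p q
    exact gammad_add hd hrel _ _ p.2.1 q.2.1
  rw [h]
  exact hhat.submatrix hf

/-- A representing measure of a sequence satisfying the column relations is carried by the
curve `y = x ^ d`. -/
theorem IsRepMeasure.ae_eq_pow {n d : ℕ} {β : ℕ → ℕ → ℝ} {μ : Measure (ℝ × ℝ)}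
    (hμ : IsRepMeasure n β μ) (hd : 1 ≤ d) (hdn : d ≤ n)
    (hrel : ∀ i j : ℕ, i + j + d ≤ 2 * n → β (i + d) j = β i (j + 1)) :
    ∀ᵐ z ∂μ, z.2 = z.1 ^ d := by
  obtain ⟨i₁, e₁⟩ := hμ 0 2 (by omega)
  obtain ⟨i₂, e₂⟩ := hμ d 1 (by omega)
  obtain ⟨i₃, e₃⟩ := hμ (d + d) 0 (by omega)
  have hsq : (fun z : ℝ × ℝ => (z.2 - z.1 ^ d) ^ 2) = fun z =>
      z.1 ^ 0 * z.2 ^ 2 - 2 * (z.1 ^ d * z.2 ^ 1) + z.1 ^ (d + d) * z.2 ^ 0 := by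
    funext z
    ring
  have i₁₂ : Integrable (fun z : ℝ × ℝ => z.1 ^ 0 * z.2 ^ 2 - 2 * (z.1 ^ d * z.2 ^ 1)) μ :=
    i₁.sub (i₂.const_mul 2)
  have hint : Integrable (fun z : ℝ × ℝ => (z.2 - z.1 ^ d) ^ 2) μ := by
    rw [hsq]
    exact i₁₂.add i₃
  have hzero : ∫ z : ℝ × ℝ, (z.2 - z.1 ^ d) ^ 2 ∂μ = 0 := by
    rw [hsq, integral_add i₁₂ i₃, integral_sub i₁ (i₂.const_mul 2),
      integral_const_mul, e₁, e₂, e₃, hrel d 0 (by omega)]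
    have := hrel 0 1 (by omega)
    rw [zero_add] at this
    rw [this]
    ring
  filter_upwards [(integral_eq_zero_iff_of_nonneg (fun z => sq_nonneg _) hint).1 hzero] with z hz
  exact sub_eq_zero.1 (pow_eq_zero_iff two_ne_zero |>.1 hz)

/-- The pure powers of the first coordinate have moments `γ` on the curve `y = x ^ d`. -/
theorem IsRepMeasure.integral_pow {n d : ℕ} {β : ℕ → ℕ → ℝ} {μ : Measure (ℝ × ℝ)}
    (hμ : IsRepMeasure n β μ) (hcurve : ∀ᵐ z ∂μ, z.2 = z.1 ^ d) {m : ℕ}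
    (hm : m % d + m / d ≤ 2 * n) :
    Integrable (fun z : ℝ × ℝ => z.1 ^ m) μ ∧ ∫ z : ℝ × ℝ, z.1 ^ m ∂μ = gammad d β m := by
  obtain ⟨hi, he⟩ := hμ _ _ hm
  have hae : (fun z : ℝ × ℝ => z.1 ^ (m % d) * z.2 ^ (m / d)) =ᵐ[μ] fun z => z.1 ^ m := by
    filter_upwards [hcurve] with z hz
    rw [hz, ← pow_mul, ← pow_add, Nat.mod_add_div]
  exact ⟨hi.congr hae, (integral_congr_ae hae).symm.trans he⟩

theorem m0_eq {n d : ℕ} (hd : 1 ≤ d) (hdn : d ≤ n) :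
    m0 n d = (d - 1) + d * (n - d + 2) := by
  obtain ⟨k, rfl⟩ := Nat.exists_eq_add_of_le hdn
  obtain ⟨e, rfl⟩ := Nat.exists_eq_add_of_le hd
  have h : (1 + e + k) * (1 + e) = (1 + e) ^ 2 + k * (1 + e) := by ring
  rw [m0, h, Nat.add_sub_cancel_left, Nat.add_sub_cancel_left, Nat.add_sub_cancel_left,
    show k * (1 + e) + 3 * (1 + e) = (e + (1 + e) * (k + 2)) + 1 by ring, Nat.add_sub_cancel]

theorem m0_mod_div {n d : ℕ} (hd : 1 ≤ d) (hdn : d ≤ n) :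
    m0 n d % d = d - 1 ∧ m0 n d / d = n - d + 2 := by
  rw [m0_eq hd hdn, Nat.add_mul_mod_self_left, Nat.add_mul_div_left _ _ hd,
    Nat.mod_eq_of_lt (by omega), Nat.div_eq_of_lt (by omega)]
  omega

theorem m0_le {n d : ℕ} (hd : 4 ≤ d) (hdn : d ≤ n) : m0 n d ≤ n * d - d + 1 := by
  rw [m0_eq (by omega) hdn]
  obtain ⟨k, rfl⟩ := Nat.exists_eq_add_of_le hdn
  obtain ⟨e, rfl⟩ := Nat.exists_eq_add_of_le hd
  have h : (4 + e + k) * (4 + e) = (3 + e + k) * (4 + e) + (4 + e) := by ring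
  rw [h, Nat.add_sub_cancel, Nat.add_sub_cancel_left, show 4 + e - 1 = 3 + e by omega]
  nlinarith

theorem SIdx'.le {n d : ℕ} (hd : 1 ≤ d) (p : SIdx' n d) : (p.1 : ℕ) ≤ n * d - d + 1 := by
  obtain ⟨⟨p, hp⟩, hpn, hpne⟩ := p
  simp only at hpn hpne ⊢
  have hdm := Nat.mod_add_div p d
  set a := p % d
  set b := p / d
  rcases Nat.eq_zero_or_pos a with ha | ha
  · have hb : b < n := by
      refine lt_of_le_of_ne (by omega) fun h => hpne ?_
      rw [← hdm, ha, h, zero_add, mul_comm]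
    have := Nat.mul_le_mul_left d (Nat.succ_le_of_lt hb)
    rw [Nat.mul_succ, mul_comm d n] at this
    omega
  · obtain ⟨a', h'⟩ := Nat.exists_eq_add_of_le (Nat.succ_le_of_lt ha)
    have h1 : d * (a' + b + 1) ≤ d * n := Nat.mul_le_mul_left d (by omega)
    have h2 : a' ≤ d * a' := Nat.le_mul_of_pos_left _ hd
    rw [mul_add, mul_add, mul_comm d n] at h1
    omega

theorem add_mod_add_div_le {n d p q : ℕ} (hd : 0 < d)
    (h : p % d + q % d < d → p % d + q % d + (p / d + q / d) ≤ n)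
    (h' : d ≤ p % d + q % d → p % d + q % d + (p / d + q / d) + 1 ≤ n + d) :
    (p + q) % d + (p + q) / d ≤ n := by
  have hpd := Nat.mod_lt p hd
  have hqd := Nat.mod_lt q hd
  rw [Nat.add_mod, Nat.add_div hd]
  split_ifs with hc
  · rw [Nat.mod_eq_sub_mod hc, Nat.mod_eq_of_lt (by omega)]
    have := h' hc
    omega
  · rw [Nat.mod_eq_of_lt (by omega)]
    have := h (by omega)
    omega

theorem SIdx'.div_lt {n d : ℕ} (p : SIdx' n d) : (p.1 : ℕ) % d = 0 → (p.1 : ℕ) / d < n := by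
  intro ha
  refine lt_of_le_of_ne (by have := p.2.1; omega) fun h => p.2.2 ?_
  rw [← Nat.mod_add_div (p.1 : ℕ) d, ha, h, zero_add, mul_comm]

/-- If the Schur complement of `C` in a moment matrix bordered by `h` and `l` vanishes, the
corresponding combination of powers vanishes almost everywhere. -/
theorem ae_eq_sum_pow_of_schur_eq_zero {ι α : Type*} [Fintype ι] [DecidableEq ι]
    [MeasurableSpace α] {μ : Measure α} {C : Matrix ι ι ℝ} {h : ι → ℝ} {l : ℝ}
    (hC : IsUnit C.det) (u : ι → α → ℝ) (v : α → ℝ)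
    (hu : ∀ i j, Integrable (fun z => u i z * u j z) μ ∧ ∫ z, u i z * u j z ∂μ = C i j)
    (huv : ∀ i, Integrable (fun z => u i z * v z) μ ∧ ∫ z, u i z * v z ∂μ = h i)
    (hv : Integrable (fun z => v z * v z) μ ∧ ∫ z, v z * v z ∂μ = l)
    (hl : l = h ⬝ᵥ C⁻¹ *ᵥ h) :
    ∀ᵐ z ∂μ, v z - ∑ i, (C⁻¹ *ᵥ h) i * u i z = 0 := by
  set c := C⁻¹ *ᵥ h with hc
  have hsq : (fun z => (v z - ∑ i, c i * u i z) ^ 2) = fun z =>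
      v z * v z - 2 * ∑ i, c i * (u i z * v z) + ∑ i, ∑ j, c i * c j * (u i z * u j z) := by
    funext z
    have h₁ : ∑ i, c i * (u i z * v z) = (∑ i, c i * u i z) * v z := by
      rw [Finset.sum_mul]
      exact Finset.sum_congr rfl fun i _ => by ring
    have h₂ : ∑ i, ∑ j, c i * c j * (u i z * u j z) =
        (∑ i, c i * u i z) * ∑ j, c j * u j z := by
      rw [Finset.sum_mul_sum]
      exact Finset.sum_congr rfl fun i _ => Finset.sum_congr rfl fun j _ => by ring
    rw [h₁, h₂]
    ring
  have j₁ (i : ι) : Integrable (fun z => c i * (u i z * v z)) μ := (huv i).1.const_mul _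
  have j₂ (i j : ι) : Integrable (fun z => c i * c j * (u i z * u j z)) μ :=
    (hu i j).1.const_mul _
  have i₁ : Integrable (fun z => 2 * ∑ i, c i * (u i z * v z)) μ :=
    (integrable_finsetSum _ fun i _ => j₁ i).const_mul 2
  have i₃ (i : ι) : Integrable (fun z => ∑ j, c i * c j * (u i z * u j z)) μ :=
    integrable_finsetSum _ fun j _ => j₂ i j
  have i₂ : Integrable (fun z => ∑ i, ∑ j, c i * c j * (u i z * u j z)) μ :=
    integrable_finsetSum _ fun i _ => i₃ i
  have i₁₂ : Integrable (fun z => v z * v z - 2 * ∑ i, c i * (u i z * v z)) μ := hv.1.sub i₁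
  have hint : Integrable (fun z => (v z - ∑ i, c i * u i z) ^ 2) μ := by
    rw [hsq]
    exact i₁₂.add i₂
  have hCc : C *ᵥ c = h := by
    rw [hc, mulVec_mulVec, mul_nonsing_inv _ hC, one_mulVec]
  have hquad : ∑ i, ∑ j, c i * c j * C i j = ∑ i, c i * h i := by
    refine Finset.sum_congr rfl fun i _ => ?_
    rw [← hCc, mulVec, dotProduct, Finset.mul_sum]
    exact Finset.sum_congr rfl fun j _ => by ring
  have hzero : ∫ z, (v z - ∑ i, c i * u i z) ^ 2 ∂μ = 0 := by
    rw [hsq, integral_add i₁₂ i₂, integral_sub hv.1 i₁, integral_const_mul,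
      integral_finsetSum _ fun i _ => j₁ i, integral_finsetSum _ fun i _ => i₃ i]
    simp_rw [integral_finsetSum _ fun j _ => j₂ _ j, integral_const_mul, hv.2,
      fun i => (huv i).2, fun i j => (hu i j).2]
    rw [hquad, hl, dotProduct_comm, dotProduct]
    ring
  filter_upwards [(integral_eq_zero_iff_of_nonneg (fun z => sq_nonneg _) hint).1 hzero] with z hz
  exact pow_eq_zero_iff two_ne_zero |>.1 hz

open Polynomial in
/-- Polynomials `X ^ m - ∑ c i X ^ e i` with all exponents `e i ≠ m` bounded by `N`
are nonzero with at most `N` roots. -/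
theorem exists_finset_roots {ι : Type*} [Fintype ι] (m N : ℕ) (e : ι → ℕ) (c : ι → ℝ)
    (hm : m ≤ N) (he : ∀ i, e i ≤ N) (hne : ∀ i, e i ≠ m) :
    ∃ s : Finset ℝ, s.card ≤ N ∧ ∀ x : ℝ, x ^ m - ∑ i, c i * x ^ e i = 0 → x ∈ s := by
  set f : ℝ[X] := X ^ m - ∑ i, C (c i) * X ^ e i with hf
  have hf0 : f ≠ 0 := by
    intro h
    have hcoeff := congrArg (fun g => g.coeff m) h
    simp [hf, coeff_X_pow, (hne _).symm] at hcoeff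
  have hdeg : f.natDegree ≤ N := by
    refine (natDegree_sub_le_of_le ((natDegree_X_pow_le m).trans hm)
      (natDegree_sum_le_of_forall_le _ _ fun i _ =>
        (natDegree_C_mul_X_pow_le _ _).trans (he i))).trans (max_self N).le
  refine ⟨f.roots.toFinset, (Multiset.toFinset_card_le _).trans ((card_roots' f).trans hdeg), ?_⟩
  intro x hx
  rw [Multiset.mem_toFinset, mem_roots hf0, IsRoot, hf]
  simpa [eval_finsetSum] using hx

/-- For `d ≥ 4`: the matrix `C₁` is positive definite, and if `λ = φ`, then the
support of every representing measure for `β` contains at most `nd − d + 1`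
points (i.e. every representing measure is concentrated on a finite set of at
most `nd − d + 1` points). -/
theorem pure_core_variety_finite (n d : ℕ) (hd : 4 ≤ d) (hdn : d ≤ n)
    (β : ℕ → ℕ → ℝ) (hpure : IsPure n d β) :
    (C1big n d β).PosDef ∧
    (lamBig n d β = phiBig n d β →
      ∀ μ : Measure (ℝ × ℝ), IsRepMeasure n β μ →
        ∃ t : Finset (ℝ × ℝ), t.card ≤ n * d - d + 1 ∧
          μ ((↑t : Set (ℝ × ℝ))ᶜ) = 0) := by
  obtain ⟨-, hrel, -, hhat⟩ := hpure
  have hC := C1big_posDef (by omega) hrel hhat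
  refine ⟨hC, fun hlam μ hμ => ?_⟩
  have hcurve := hμ.ae_eq_pow (by omega) hdn hrel
  obtain ⟨hmod, hdiv⟩ := m0_mod_div (n := n) (d := d) (by omega) hdn
  have hpow {a b : ℕ} (hab : (a + b) % d + (a + b) / d ≤ 2 * n) :
      Integrable (fun z : ℝ × ℝ => z.1 ^ a * z.1 ^ b) μ ∧
        ∫ z : ℝ × ℝ, z.1 ^ a * z.1 ^ b ∂μ = gammad d β (a + b) := by
    simp_rw [← pow_add]
    exact hμ.integral_pow hcurve hab
  have hae := ae_eq_sum_pow_of_schur_eq_zero (μ := μ) (C := C1big n d β) (h := hbig n d β)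
    (isUnit_iff_ne_zero.2 hC.det_pos.ne') (fun p z => z.1 ^ (p.1 : ℕ)) (fun z => z.1 ^ m0 n d)
    (fun p q => hpow (add_mod_add_div_le (by omega)
      (by have := p.2.1; have := q.2.1; omega) (by have := p.2.1; have := q.2.1; omega)))
    (fun p => hpow (add_mod_add_div_le (by omega)
      (by have := p.2.1; have := p.div_lt; omega) (by have := p.2.1; have := p.div_lt; omega)))
    (l := lamBig n d β)
    (by
      rw [lamBig, two_mul]
      exact hpow (add_mod_add_div_le (by omega) (by omega) (by omega)))
    hlam
  obtain ⟨s, hs, hroots⟩ := exists_finset_roots (m0 n d) (n * d - d + 1)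
    (fun p : SIdx' n d => (p.1 : ℕ)) ((C1big n d β)⁻¹ *ᵥ hbig n d β) (m0_le hd hdn)
    (fun p => p.le (by omega)) (fun p hp => by have := p.2.1; rw [hp] at this; omega)
  refine ⟨s.image fun x => (x, x ^ d), Finset.card_image_le.trans hs, ?_⟩
  refine mem_ae_iff.1 ?_
  filter_upwards [hcurve, hae] with z hz hz'
  exact Finset.mem_coe.2 (Finset.mem_image.2 ⟨z.1, hroots _ hz', Prod.ext rfl hz.symm⟩)
end
end
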